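/- In any finite execution of the multi-writer auditable register implementation (Algorithm 1), the AUDIT operations are accurate: if the response of an AUDIT operation aop contains the pair (j, v), then there exists a READ operation by process p_j returning v that precedes aop in the linearization λ. -/

import Mathlib

/-!
# An operational model of Algorithm 1 (multi-writer auditable register)

The algorithm implements an `n`-writer `m`-reader auditable register from an
unbounded array `SLR[-1,0,1,...]` of `(m+n)`-sliding registers, a max register
`M` storing a triple `(widx, ridx, auditset)` (ordered by its first field,
modelled here as an atomic object), and an array `H[1..m]` of single-writer
registers.  Each line of the pseudo-code is a step; readers, writers and
auditors are modelled by explicit program counters, and executions are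
alternating sequences of configurations and labelled steps starting from the
initial configuration.
-/

namespace Alg1

/-- Values stored in the auditable register. -/
abbrev Val := ℕ

/-- Entries of the sliding registers: `w`-tuples `(w, j, v, h)` posted by
    writers (with `h` a helping set of readers) and reader identifiers. -/
inductive Entry (m n : ℕ) where
  | w (j : Fin n) (v : Val) (h : Finset (Fin m))
  | r (i : Fin m)

variable {m n : ℕ}

def Entry.isW : Entry m n → Bool
  | .w _ _ _ => true
  | .r _ => false

/-- Does the window contain a `w`-tuple? -/
def hasW (win : List (Entry m n)) : Bool := win.any Entry.isW

/-- The first `w`-tuple in a window, if any. -/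
def firstW : List (Entry m n) → Option (Fin n × Val × Finset (Fin m))
  | [] => none
  | .w j v h :: _ => some (j, v, h)
  | .r _ :: rest => firstW rest

/-- `getValue`: the value of the first `w`-tuple of a window (default `0`). -/
def wval (win : List (Entry m n)) : Val := ((firstW win).map fun t => t.2.1).getD 0

/-- Reader identifiers that precede every `w`-tuple of a window. -/
def preW : List (Entry m n) → Finset (Fin m)
  | [] => ∅
  | .w _ _ _ :: _ => ∅
  | .r i :: rest => insert i (preW rest)

/-- `READERS(win)`: readers preceding every `w`-tuple, together with the
    helping set of the first `w`-tuple, if any. -/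
def readersOf (win : List (Entry m n)) : Finset (Fin m) :=
  preW win ∪ ((firstW win).map fun t => t.2.2).getD ∅

/-- Content of the max register `M`: a triple `(widx, ridx, auditset)`,
    ordered by the first field. -/
structure MVal (m : ℕ) where
  widx : ℤ
  ridx : Fin m → ℤ
  aud : Finset (Fin m × Val)

/-- Semantics of `writeMax` on `M`. -/
def wmax (old new : MVal m) : MVal m := if old.widx < new.widx then new else old

/-- The triple written to `M` after reading window `win` from `SLR[x]`:
    `(x+1, ridx[j ∈ READERS(win)] := x, auditset ∪ {(j, lv) : j ∈ READERS(win)})`. -/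
def mArg (mc : MVal m) (win : List (Entry m n)) (x : ℤ) (lv : Val) : MVal m where
  widx := x + 1
  ridx := fun j => if j ∈ readersOf win then x else mc.ridx j
  aud := mc.aud ∪ (readersOf win).image fun j => (j, lv)

/-- Write to a `k`-sliding register: append, keeping the last `k` entries. -/
def slide (k : ℕ) (l : List (Entry m n)) (e : Entry m n) : List (Entry m n) :=
  let l' := l ++ [e]
  l'.drop (l'.length - k)

/-- Program counter of a reader (one state per line of the pseudo-code). -/
inductive RPC where
  | idle
  | precheck   -- read `SLR[lsr]` (line `rd_last_wd`)
  | preM       -- read `M` (line `new_write`)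
  | preHelp    -- `writeMax` on `M` (line `rd_help_M1`)
  | loopM      -- read `M` at the head of the repeat loop (line `rd_M`)
  | helpVal    -- found help: read `SLR[lsr-1]` (`getValue`, line `rd_return_help`)
  | annH       -- write `H[i] := lsr` (line `rd_annouce_att`)
  | wSLR       -- write `i` to `SLR[lsr]` (line `rd_do_att`)
  | rSLR       -- read `SLR[lsr]` (line `rd_do_att`)
  | gVal       -- read `SLR[lsr-1]` (`getValue`, line `rd_val`)
  | helpChk    -- help the pending write to complete (line `rd_help_M2`)
  | loopEnd    -- evaluate the until condition (line `rd_att_success`)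
  | retNow     -- return `lval`

structure RState (m n : ℕ) where
  lsr : ℤ
  lval : Val
  mc : MVal m
  win : List (Entry m n)
  it : ℕ          -- number of iterations of the repeat loop of the current READ
  pc : RPC

/-- Program counter of a writer. -/
inductive WPC where
  | idle
  | readM    -- read `M` (line `w_read_M`)
  | scanH    -- read `H[k]` (line `w_att`)
  | scanS    -- read `SLR[a_k]` (line `w_help_wd`)
  | post     -- write the `w`-tuple to `SLR[widx]` (line `w_write_SLR`)
  | postR    -- read `SLR[widx]`
  | postV    -- read `SLR[widx-1]` (`getValue`)
  | postM    -- `writeMax` on `M` (line `w_write_M`)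
  | wret     -- return

structure WState (m n : ℕ) where
  v : Val
  mc : MVal m
  toHelp : Finset (Fin m)
  k : ℕ
  a : ℤ
  win : List (Entry m n)
  val : Val
  pc : WPC

/-- Program counter of an auditor. -/
inductive APC where
  | idle
  | aM       -- read `M` (line `adt_read_M`)
  | aR       -- read `SLR[widx]` (line `adt_val`)
  | aV       -- read `SLR[widx-1]` (`getValue`, line `adt_val`)
  | aret     -- return the audit set

structure AState (m n : ℕ) where
  mc : MVal m
  win : List (Entry m n)
  val : Val
  pc : APC

/-- Processes: `m` readers, `n` writers, and arbitrarily many auditors. -/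
inductive Proc (m n : ℕ) where
  | rdr (i : Fin m)
  | wtr (j : Fin n)
  | adt (a : ℕ)
  deriving DecidableEq

/-- A configuration: shared memory plus the local state of every process. -/
structure Config (m n : ℕ) where
  slr : ℤ → List (Entry m n)
  M : MVal m
  H : Fin m → ℤ
  rst : Fin m → RState m n
  wst : Fin n → WState m n
  ast : ℕ → AState m n

/-- Step labels: invocations and responses of high-level operations, and
    primitive operations applied to the base objects. -/
inductive Lbl (m n : ℕ) where
  | invRead (i : Fin m)
  | respRead (i : Fin m) (v : Val)
  | invWrite (j : Fin n) (v : Val)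
  | respWrite (j : Fin n)
  | invAudit (a : ℕ)
  | respAudit (a : ℕ) (A : Finset (Fin m × Val))
  | slrRead (p : Proc m n) (x : ℤ) (win : List (Entry m n))
  | slrWrite (p : Proc m n) (x : ℤ) (e : Entry m n)
  | mRead (p : Proc m n) (v : MVal m)
  | mWrite (p : Proc m n) (v : MVal m)
  | hRead (j : Fin n) (k : Fin m) (a : ℤ)
  | hWrite (i : Fin m) (x : ℤ)
  | tau (p : Proc m n)

def upR (c : Config m n) (i : Fin m) (s : RState m n) : Config m n :=
  { c with rst := Function.update c.rst i s }

def upW (c : Config m n) (j : Fin n) (s : WState m n) : Config m n :=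
  { c with wst := Function.update c.wst j s }

def upA (c : Config m n) (a : ℕ) (s : AState m n) : Config m n :=
  { c with ast := Function.update c.ast a s }

/-- The transition relation of Algorithm 1. -/
def Step (c : Config m n) (l : Lbl m n) (c' : Config m n) : Prop :=
  match l with
  | .invRead i =>
      let s := c.rst i
      s.pc = .idle ∧
      c' = upR c i { s with it := 0, pc := if 0 ≤ s.lsr then RPC.precheck else RPC.loopM }
  | .respRead i v =>
      let s := c.rst i
      s.pc = .retNow ∧ v = s.lval ∧ c' = upR c i { s with pc := .idle }
  | .invWrite j v =>
      let s := c.wst j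
      s.pc = .idle ∧ c' = upW c j { s with v := v, pc := .readM }
  | .respWrite j =>
      let s := c.wst j
      s.pc = .wret ∧ c' = upW c j { s with pc := .idle }
  | .invAudit a =>
      let s := c.ast a
      s.pc = .idle ∧ c' = upA c a { s with pc := .aM }
  | .respAudit a A =>
      let s := c.ast a
      s.pc = .aret ∧
      A = s.mc.aud ∪ (readersOf s.win).image (fun j => (j, s.val)) ∧
      c' = upA c a { s with pc := .idle }
  | .slrRead p x win =>
      win = c.slr x ∧
      (match p with
       | .rdr i =>
          let s := c.rst i
          (s.pc = .precheck ∧ x = s.lsr ∧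
             c' = upR c i { s with win := win, pc := if hasW win then RPC.preM else RPC.retNow }) ∨
          (s.pc = .helpVal ∧ x = s.lsr - 1 ∧
             c' = upR c i { s with lval := wval win, pc := .retNow }) ∨
          (s.pc = .rSLR ∧ x = s.lsr ∧
             c' = upR c i { s with win := win, pc := .gVal }) ∨
          (s.pc = .gVal ∧ x = s.lsr - 1 ∧
             c' = upR c i { s with lval := wval win, pc := .helpChk })
       | .wtr j =>
          let s := c.wst j
          (s.pc = .scanS ∧ x = s.a ∧
             (∃ hk : s.k < m,
               c' = upW c j { s with toHelp := if (⟨s.k, hk⟩ : Fin m) ∈ readersOf win then s.toHelp else insert (⟨s.k, hk⟩ : Fin m) s.toHelp, k := s.k + 1, pc := .scanH })) ∨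
          (s.pc = .postR ∧ x = s.mc.widx ∧
             c' = upW c j { s with win := win, pc := .postV }) ∨
          (s.pc = .postV ∧ x = s.mc.widx - 1 ∧
             c' = upW c j { s with val := wval win, pc := .postM })
       | .adt a =>
          let s := c.ast a
          (s.pc = .aR ∧ x = s.mc.widx ∧
             c' = upA c a { s with win := win, pc := .aV }) ∨
          (s.pc = .aV ∧ x = s.mc.widx - 1 ∧
             c' = upA c a { s with val := wval win, pc := .aret }))
  | .slrWrite p x e =>
      (match p with
       | .rdr i =>
          let s := c.rst i
          s.pc = .wSLR ∧ x = s.lsr ∧ e = .r i ∧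
          c' = { upR c i { s with pc := .rSLR } with
                 slr := Function.update c.slr x (slide (m + n) (c.slr x) e) }
       | .wtr j =>
          let s := c.wst j
          s.pc = .post ∧ x = s.mc.widx ∧ e = .w j s.v s.toHelp ∧
          c' = { upW c j { s with pc := .postR } with
                 slr := Function.update c.slr x (slide (m + n) (c.slr x) e) }
       | .adt _ => False)
  | .mRead p v =>
      v = c.M ∧
      (match p with
       | .rdr i =>
          let s := c.rst i
          (s.pc = .preM ∧
             c' = upR c i { s with mc := v, pc := if v.widx = s.lsr then RPC.preHelp else RPC.loopM }) ∨
          (s.pc = .loopM ∧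
             c' = upR c i (if s.lsr < v.ridx i then
                { s with mc := v, it := s.it + 1, lsr := v.ridx i, pc := .helpVal }
              else
                { s with mc := v, it := s.it + 1, lsr := v.widx, pc := .annH }))
       | .wtr j =>
          let s := c.wst j
          s.pc = .readM ∧
          c' = upW c j { s with mc := v, toHelp := ∅, k := 0, pc := .scanH }
       | .adt a =>
          let s := c.ast a
          s.pc = .aM ∧ c' = upA c a { s with mc := v, pc := .aR })
  | .mWrite p v =>
      (match p with
       | .rdr i =>
          let s := c.rst i
          (s.pc = .preHelp ∧ v = mArg s.mc s.win s.lsr s.lval ∧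
             c' = { upR c i { s with pc := .loopM } with M := wmax c.M v }) ∨
          (s.pc = .helpChk ∧ hasW s.win = true ∧ v = mArg s.mc s.win s.lsr s.lval ∧
             c' = { upR c i { s with pc := .loopEnd } with M := wmax c.M v })
       | .wtr j =>
          let s := c.wst j
          s.pc = .postM ∧ v = mArg s.mc s.win s.mc.widx s.val ∧
          c' = { upW c j { s with pc := .wret } with M := wmax c.M v }
       | .adt _ => False)
  | .hRead j k a =>
      let s := c.wst j
      s.pc = .scanH ∧ (k : ℕ) = s.k ∧ a = c.H k ∧
      c' = upW c j (if s.mc.ridx k < a then { s with a := a, pc := .scanS }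
                    else { s with k := s.k + 1 })
  | .hWrite i x =>
      let s := c.rst i
      s.pc = .annH ∧ x = s.lsr ∧
      c' = { upR c i { s with pc := .wSLR } with H := Function.update c.H i x }
  | .tau p =>
      match p with
      | .rdr i =>
          let s := c.rst i
          (s.pc = .helpChk ∧ hasW s.win = false ∧
             c' = upR c i { s with pc := .loopEnd }) ∨
          (s.pc = .loopEnd ∧
             c' = upR c i { s with pc := if i ∈ readersOf s.win then RPC.retNow else RPC.loopM })
      | .wtr j =>
          let s := c.wst j
          s.pc = .scanH ∧ s.k = m ∧ c' = upW c j { s with pc := .post }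
      | .adt _ => False

/-- The initial configuration: `SLR[-1]` holds `(w, j₀, v₀, ∅)`, all other
    sliding registers are empty, `M = (0, [-1,…,-1], ∅)`, `H = [-1,…,-1]`,
    and every process is idle (readers start with `lsr = -1`). -/
def init (m n : ℕ) (v0 : Val) (j0 : Fin n) : Config m n where
  slr := fun x => if x = -1 then [.w j0 v0 ∅] else []
  M := ⟨0, fun _ => -1, ∅⟩
  H := fun _ => -1
  rst := fun _ => ⟨-1, v0, ⟨0, fun _ => -1, ∅⟩, [], 0, .idle⟩
  wst := fun _ => ⟨v0, ⟨0, fun _ => -1, ∅⟩, ∅, 0, -1, [], v0, .idle⟩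
  ast := fun _ => ⟨⟨0, fun _ => -1, ∅⟩, [], v0, .idle⟩

/-- A finite execution of Algorithm 1: configurations `cfg 0, …, cfg len`
    connected by labelled steps. -/
structure Exec (m n : ℕ) (v0 : Val) (j0 : Fin n) where
  len : ℕ
  cfg : ℕ → Config m n
  lbl : ℕ → Lbl m n
  h0 : cfg 0 = init m n v0 j0
  hstep : ∀ t, t < len → Step (cfg t) (lbl t) (cfg (t + 1))

variable {v0 : Val} {j0 : Fin n}

/-! ### Derived notions -/

/-- The process performing a step. -/
def procOf : Lbl m n → Proc m n
  | .invRead i => .rdr i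
  | .respRead i _ => .rdr i
  | .invWrite j _ => .wtr j
  | .respWrite j => .wtr j
  | .invAudit a => .adt a
  | .respAudit a _ => .adt a
  | .slrRead p _ _ => p
  | .slrWrite p _ _ => p
  | .mRead p _ => p
  | .mWrite p _ => p
  | .hRead j _ _ => .wtr j
  | .hWrite i _ => .rdr i
  | .tau p => p

/-- The label writes a `w`-tuple to `SLR[x]`. -/
def isWWrite (l : Lbl m n) (x : ℤ) : Prop :=
  ∃ p j v h, l = .slrWrite p x (.w j v h)

/-- Step `t` is the first write of a `w`-tuple to `SLR[x]` in the execution. -/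
def FirstWWriteAt (E : Exec m n v0 j0) (x : ℤ) (t : ℕ) : Prop :=
  t < E.len ∧ isWWrite (E.lbl t) x ∧ ∀ t', t' < t → ¬ isWWrite (E.lbl t') x

/-- Step `t` changes `M.widx` from `ℓ - 1` to `ℓ`. -/
def WidxChangeAt (E : Exec m n v0 j0) (ℓ : ℤ) (t : ℕ) : Prop :=
  t < E.len ∧ (∃ p v, E.lbl t = .mWrite p v) ∧
  (E.cfg t).M.widx = ℓ - 1 ∧ (E.cfg (t + 1)).M.widx = ℓ

/-- `x` is the largest index of a sliding register containing a `w`-tuple. -/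
def WIDXis (c : Config m n) (x : ℤ) : Prop :=
  hasW (c.slr x) = true ∧ ∀ y : ℤ, x < y → hasW (c.slr y) = false

/-- Configuration in region `D_ℓ`: `M.widx = ℓ = WIDX + 1`. -/
def inD (c : Config m n) (ℓ : ℤ) : Prop := c.M.widx = ℓ ∧ WIDXis c (ℓ - 1)

/-- Configuration in region `E_ℓ`: `M.widx = ℓ = WIDX`. -/
def inE (c : Config m n) (ℓ : ℤ) : Prop := c.M.widx = ℓ ∧ WIDXis c ℓ

/-! ### Classification of operations, and linearizations -/

/-- Classification of the operations of Algorithm 1. -/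
inductive Kind where
  | silentR | directR | helpedR | visibleW | hiddenW | defA | nondefA
  deriving DecidableEq

/-- Rank used by the linearization rules `R1`–`R4` within a block of
    operations with the same index. -/
def rank : Kind → ℕ
  | .silentR => 0
  | .directR => 0
  | .nondefA => 0
  | .helpedR => 1
  | .defA => 2
  | .hiddenW => 3
  | .visibleW => 4

def Kind.isRead : Kind → Prop
  | .silentR => True | .directR => True | .helpedR => True
  | _ => False

def Kind.isWrite : Kind → Prop
  | .visibleW => True | .hiddenW => True
  | _ => False

def Kind.isAudit : Kind → Prop
  | .defA => True | .nondefA => True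
  | _ => False

/-- The data of a classified operation: its process, invocation step, optional
    response step, kind, associated sliding-register index `idx`, its
    characteristic step `key` on `SLR[idx]` (used by the linearization rules),
    its value (return value of a READ / input of a WRITE) and, for an AUDIT,
    the returned audit set. -/
structure OpData (m n : ℕ) where
  proc : Proc m n
  inv : ℕ
  resp : Option ℕ
  kind : Kind
  idx : ℤ
  key : ℕ
  val : Val
  aset : Finset (Fin m × Val)

/-- The label is a response event of process `p`. -/
def isRespOf (l : Lbl m n) (p : Proc m n) : Prop :=
  (∃ i v, p = .rdr i ∧ l = .respRead i v) ∨
  (∃ j, p = .wtr j ∧ l = .respWrite j) ∨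
  (∃ a A, p = .adt a ∧ l = .respAudit a A)

/-- `resp` is the matching response of the operation of `p` invoked at `a`
    (or the operation is pending if `resp = none`). -/
def RespMatch (E : Exec m n v0 j0) (p : Proc m n) (a : ℕ) : Option ℕ → Prop
  | some b => a < b ∧ b < E.len ∧ isRespOf (E.lbl b) p ∧
      ∀ t, a < t → t < b → ¬ isRespOf (E.lbl t) p
  | none => ∀ t, a < t → t < E.len → ¬ isRespOf (E.lbl t) p

/-- `x` is the smallest index `> x0` of a sliding register in which reader `i`
    is recorded (evaluated in the final configuration). -/
def minRecIdx (E : Exec m n v0 j0) (i : Fin m) (x0 x : ℤ) : Prop :=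
  x0 < x ∧ i ∈ readersOf ((E.cfg E.len).slr x) ∧
    ∀ y : ℤ, x0 < y → y < x → i ∉ readersOf ((E.cfg E.len).slr y)

/-- The return value of a classified READ: the actual response if the READ is
    complete; for a pending classified READ (completed in `H'`), the value of
    the first `w`-tuple of `SLR[idx-1]`. -/
def ReadValOK (E : Exec m n v0 j0) (o : OpData m n) (i : Fin m) : Prop :=
  match o.resp with
  | some b => E.lbl b = .respRead i o.val
  | none => o.val = wval ((E.cfg E.len).slr (o.idx - 1))

/-- `o` describes a classified operation of the execution `E`. -/
def IsOp (E : Exec m n v0 j0) (o : OpData m n) : Prop :=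
  o.inv < E.len ∧ RespMatch E o.proc o.inv o.resp ∧
  match o.kind with
  | .silentR =>
      ∃ i b win, o.proc = .rdr i ∧ o.resp = some b ∧
        E.lbl o.inv = .invRead i ∧
        (∃ t', t' < o.inv ∧ E.lbl t' = .invRead i) ∧
        o.idx = ((E.cfg o.inv).rst i).lsr ∧
        o.inv < o.key ∧ o.key < b ∧
        E.lbl o.key = .slrRead (.rdr i) o.idx win ∧
        ((E.cfg o.key).rst i).pc = .precheck ∧
        hasW win = false ∧
        E.lbl b = .respRead i o.val ∧
        o.aset = ∅
  | .directR =>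
      ∃ i, o.proc = .rdr i ∧ E.lbl o.inv = .invRead i ∧
        minRecIdx E i ((E.cfg o.inv).rst i).lsr o.idx ∧
        i ∈ preW ((E.cfg E.len).slr o.idx) ∧
        o.inv < o.key ∧ o.key < E.len ∧
        E.lbl o.key = .slrWrite (.rdr i) o.idx (.r i) ∧
        (∀ b, o.resp = some b → o.key < b) ∧
        ReadValOK E o i ∧ o.aset = ∅
  | .helpedR =>
      ∃ i, o.proc = .rdr i ∧ E.lbl o.inv = .invRead i ∧
        minRecIdx E i ((E.cfg o.inv).rst i).lsr o.idx ∧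
        i ∉ preW ((E.cfg E.len).slr o.idx) ∧
        o.key = o.inv ∧ ReadValOK E o i ∧ o.aset = ∅
  | .visibleW =>
      ∃ j h, o.proc = .wtr j ∧ E.lbl o.inv = .invWrite j o.val ∧
        o.inv < o.key ∧ o.key < E.len ∧
        E.lbl o.key = .slrWrite (.wtr j) o.idx (.w j o.val h) ∧
        (∀ b, o.resp = some b → o.key < b) ∧
        firstW ((E.cfg E.len).slr o.idx) = some (j, o.val, h) ∧
        o.aset = ∅
  | .hiddenW =>
      ∃ j h, o.proc = .wtr j ∧ E.lbl o.inv = .invWrite j o.val ∧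
        o.inv < o.key ∧ o.key < E.len ∧
        E.lbl o.key = .slrWrite (.wtr j) o.idx (.w j o.val h) ∧
        (∀ b, o.resp = some b → o.key < b) ∧
        firstW ((E.cfg E.len).slr o.idx) ≠ some (j, o.val, h) ∧
        o.aset = ∅
  | .defA =>
      ∃ a b tM mv win, o.proc = .adt a ∧ o.resp = some b ∧
        E.lbl o.inv = .invAudit a ∧
        o.inv < tM ∧ tM < o.key ∧ o.key < b ∧
        E.lbl tM = .mRead (.adt a) mv ∧ ((E.cfg tM).ast a).pc = .aM ∧
        o.idx = mv.widx ∧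
        E.lbl o.key = .slrRead (.adt a) o.idx win ∧
        ((E.cfg o.key).ast a).pc = .aR ∧
        hasW win = true ∧
        E.lbl b = .respAudit a o.aset ∧ o.val = 0
  | .nondefA =>
      ∃ a b tM mv win, o.proc = .adt a ∧ o.resp = some b ∧
        E.lbl o.inv = .invAudit a ∧
        o.inv < tM ∧ tM < o.key ∧ o.key < b ∧
        E.lbl tM = .mRead (.adt a) mv ∧ ((E.cfg tM).ast a).pc = .aM ∧
        o.idx = mv.widx ∧
        E.lbl o.key = .slrRead (.adt a) o.idx win ∧
        ((E.cfg o.key).ast a).pc = .aR ∧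
        hasW win = false ∧
        E.lbl b = .respAudit a o.aset ∧ o.val = 0

/-- `o` terminates (its response event occurs) before `o'` starts. -/
def EndsBefore (o o' : OpData m n) : Prop :=
  ∃ b, o.resp = some b ∧ b < o'.inv

/-- `lt` is a linearization of the classified operations of `E` obeying the
    rules `R0`–`R4`: a strict total order on classified operations, ordering
    operations by increasing `idx` (`R0`); within the same `idx`, first
    silent READs, direct READs and non-definitive AUDITs ordered by their
    characteristic step on `SLR[idx]` (`R1`), then helped READs in arbitrary
    order followed by the definitive AUDITs ordered by their read of
    `SLR[idx]` (`R2`), then the hidden WRITEs ordered by their write to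
    `SLR[idx]` (`R3`), and the visible WRITE last (`R4`). -/
def LinOK (E : Exec m n v0 j0) (lt : OpData m n → OpData m n → Prop) : Prop :=
  (∀ o, IsOp E o → ¬ lt o o) ∧
  (∀ o₁ o₂ o₃, IsOp E o₁ → IsOp E o₂ → IsOp E o₃ →
      lt o₁ o₂ → lt o₂ o₃ → lt o₁ o₃) ∧
  (∀ o₁ o₂, IsOp E o₁ → IsOp E o₂ → o₁ ≠ o₂ → lt o₁ o₂ ∨ lt o₂ o₁) ∧
  (∀ o₁ o₂, IsOp E o₁ → IsOp E o₂ → o₁.idx < o₂.idx → lt o₁ o₂) ∧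
  (∀ o₁ o₂, IsOp E o₁ → IsOp E o₂ → o₁.idx = o₂.idx →
      rank o₁.kind < rank o₂.kind → lt o₁ o₂) ∧
  (∀ o₁ o₂, IsOp E o₁ → IsOp E o₂ → o₁.idx = o₂.idx →
      rank o₁.kind = rank o₂.kind → o₁.kind ≠ .helpedR →
      o₁.key < o₂.key → lt o₁ o₂)

/-! ### List lemmas -/

theorem hasW_append (l r : List (Entry m n)) : hasW (l ++ r) = (hasW l || hasW r) := by
  simp [hasW]

theorem firstW_append {l : List (Entry m n)} (r : List (Entry m n)) (h : hasW l = true) :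
    firstW (l ++ r) = firstW l := by
  induction l with
  | nil => simp [hasW] at h
  | cons e l ih =>
    cases e with
    | w j v hh => rfl
    | r i => exact ih (by simpa [hasW, Entry.isW] using h)

theorem preW_append {l : List (Entry m n)} (r : List (Entry m n)) (h : hasW l = true) :
    preW (l ++ r) = preW l := by
  induction l with
  | nil => simp [hasW] at h
  | cons e l ih =>
    cases e with
    | w j v hh => rfl
    | r i =>
      have := ih (by simpa [hasW, Entry.isW] using h)
      simp [preW, this]

theorem preW_append' {l : List (Entry m n)} (r : List (Entry m n)) (h : hasW l = false) :
    preW (l ++ r) = preW l ∪ preW r := by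
  induction l with
  | nil => simp [preW]
  | cons e l ih =>
    cases e with
    | w j v hh => simp [hasW, Entry.isW] at h
    | r i =>
      have := ih (by simpa [hasW, Entry.isW] using h)
      simp [preW, this]

theorem firstW_append' {l : List (Entry m n)} (r : List (Entry m n)) (h : hasW l = false) :
    firstW (l ++ r) = firstW r := by
  induction l with
  | nil => rfl
  | cons e l ih =>
    cases e with
    | w j v hh => simp [hasW, Entry.isW] at h
    | r i => exact ih (by simpa [hasW, Entry.isW] using h)

theorem firstW_none {l : List (Entry m n)} (h : hasW l = false) : firstW l = none := by
  have := firstW_append' [] h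
  simpa [firstW] using this

theorem readersOf_noW {l : List (Entry m n)} (h : hasW l = false) : readersOf l = preW l := by
  simp [readersOf, firstW_none h]

theorem readersOf_append {l : List (Entry m n)} (r : List (Entry m n)) (h : hasW l = true) :
    readersOf (l ++ r) = readersOf l := by
  simp [readersOf, firstW_append r h, preW_append r h]

theorem hasW_pre {l l' : List (Entry m n)} (hp : l <+: l') (h : hasW l = true) :
    hasW l' = true := by
  obtain ⟨r, rfl⟩ := hp
  simp [hasW_append, h]

theorem readersOf_pre {l l' : List (Entry m n)} (hp : l <+: l') (h : hasW l = true) :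
    readersOf l' = readersOf l := by
  obtain ⟨r, rfl⟩ := hp
  exact readersOf_append r h

theorem wval_pre {l l' : List (Entry m n)} (hp : l <+: l') (h : hasW l = true) :
    wval l' = wval l := by
  obtain ⟨r, rfl⟩ := hp
  simp [wval, firstW_append r h]

theorem preW_mono {l l' : List (Entry m n)} (hp : l <+: l') : preW l ⊆ preW l' := by
  obtain ⟨r, rfl⟩ := hp
  cases h : hasW l with
  | true => rw [preW_append r h]
  | false => rw [preW_append' r h]; exact Finset.subset_union_left

theorem preW_sub (l : List (Entry m n)) : preW l ⊆ readersOf l := Finset.subset_union_left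

theorem readersOf_mono {l l' : List (Entry m n)} (hp : l <+: l') :
    readersOf l ⊆ readersOf l' := by
  cases h : hasW l with
  | true => rw [readersOf_pre hp h]
  | false =>
    rw [readersOf_noW h]
    exact (preW_mono hp).trans (preW_sub l')

theorem mem_r {l : List (Entry m n)} {i : Fin m} (h : Entry.r i ∈ l) :
    hasW l = true ∨ i ∈ preW l := by
  induction l with
  | nil => simp at h
  | cons e l ih =>
    cases e with
    | w j v hh => left; simp [hasW, Entry.isW]
    | r k =>
      rcases List.mem_cons.1 h with h | h
      · right; cases h; simp [preW]
      · rcases ih h with h | h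
        · left; simpa [hasW, Entry.isW] using h
        · right; simp [preW, h]

/-! ### Invariants -/

def Rec (slr : ℤ → List (Entry m n)) (i : Fin m) (y : ℤ) : Prop := i ∈ readersOf (slr y)

structure MOK (slr : ℤ → List (Entry m n)) (M v : MVal m) : Prop where
  nn : 0 ≤ v.widx
  le : v.widx ≤ M.widx
  eq : v.widx = M.widx → v = M
  aud : ∀ k u, (k, u) ∈ v.aud →
    ∃ y, 0 ≤ y ∧ y < v.widx ∧ Rec slr k y ∧ u = wval (slr (y - 1))

structure SI (slr : ℤ → List (Entry m n)) (M : MVal m) : Prop where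
  mok : MOK slr M M
  full : ∀ x, -1 ≤ x → x < M.widx → hasW (slr x) = true
  empty : ∀ x, M.widx < x → slr x = []
  neg : ∀ x, x < 0 → readersOf (slr x) = ∅
  rlow : ∀ k, -1 ≤ M.ridx k
  rhigh : ∀ k, M.ridx k < M.widx
  rrec : ∀ k, M.ridx k = -1 ∨ Rec slr k (M.ridx k)
  rmax : ∀ k y, Rec slr k y → y < M.widx → y ≤ M.ridx k

theorem SI.rec_nn {slr : ℤ → List (Entry m n)} {M : MVal m} (h : SI slr M) {k y}
    (hr : Rec slr k y) : 0 ≤ y := by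
  by_contra hy
  have := h.neg y (by omega)
  simp [Rec, this] at hr

theorem SI.rec_le {slr : ℤ → List (Entry m n)} {M : MVal m} (h : SI slr M) {k y}
    (hr : Rec slr k y) : y ≤ M.widx := by
  by_contra hy
  have := h.empty y (by omega)
  simp [Rec, this, readersOf, preW, firstW] at hr

/-- Reader is engaged in a READ that will not be silent and has not found its value yet. -/
def act : RPC → Bool
  | .idle => false
  | .precheck => false
  | .helpVal => false
  | .retNow => false
  | _ => true

def LV (slr : ℤ → List (Entry m n)) (i : Fin m) (s : RState m n) : Prop :=
  Rec slr i s.lsr ∧ s.lval = wval (slr (s.lsr - 1))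

def RLoc (slr : ℤ → List (Entry m n)) (M : MVal m) (i : Fin m) (s : RState m n) (g : ℤ) : Prop :=
  match s.pc with
  | .idle => (s.lsr = -1 ∨ LV slr i s) ∧ ∀ y, Rec slr i y → y ≤ s.lsr
  | .retNow => (s.lsr = -1 ∨ LV slr i s) ∧ ∀ y, Rec slr i y → y ≤ s.lsr
  | .precheck => g = s.lsr ∧ LV slr i s ∧ ∀ y, Rec slr i y → y ≤ s.lsr
  | .preM => g = s.lsr ∧ LV slr i s ∧ s.win <+: slr s.lsr ∧ hasW s.win = true
  | .preHelp => g = s.lsr ∧ LV slr i s ∧ s.win <+: slr s.lsr ∧ hasW s.win = true ∧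
      s.mc.widx = s.lsr
  | .loopM => s.lsr < M.widx ∧ ∀ y, Rec slr i y → g < y → s.lsr < y
  | .helpVal => Rec slr i s.lsr ∧ ∀ y, Rec slr i y → y ≤ s.lsr
  | .annH => g < s.lsr ∧ s.mc.widx = s.lsr
  | .wSLR => g < s.lsr ∧ s.mc.widx = s.lsr
  | .rSLR => g < s.lsr ∧ s.mc.widx = s.lsr ∧ Entry.r i ∈ slr s.lsr
  | .gVal => g < s.lsr ∧ s.mc.widx = s.lsr ∧ s.win <+: slr s.lsr ∧
      (hasW s.win = true ∨ i ∈ preW s.win)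
  | .helpChk => g < s.lsr ∧ s.mc.widx = s.lsr ∧ s.win <+: slr s.lsr ∧
      (hasW s.win = true ∨ i ∈ preW s.win) ∧ s.lval = wval (slr (s.lsr - 1))
  | .loopEnd => g < s.lsr ∧ s.mc.widx = s.lsr ∧ s.win <+: slr s.lsr ∧
      (hasW s.win = true ∨ i ∈ preW s.win) ∧ s.lval = wval (slr (s.lsr - 1)) ∧
      (hasW s.win = true → s.lsr < M.widx)

structure RI (slr : ℤ → List (Entry m n)) (M : MVal m) (hh : ℤ) (i : Fin m)
    (s : RState m n) (g : ℤ) : Prop where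
  mok : MOK slr M s.mc
  g1 : -1 ≤ g
  gl : g ≤ s.lsr
  lM : s.lsr ≤ M.widx
  hl : hh ≤ s.lsr
  grec : g = -1 ∨ Rec slr i g
  low : ∀ y, Rec slr i y → g < y → s.lsr ≤ y
  uniq : ∀ y y', Rec slr i y → Rec slr i y' → g < y → g < y' → y = y'
  loc : RLoc slr M i s g

def Safe (slr : ℤ → List (Entry m n)) (M : MVal m) (rst : Fin m → RState m n) (g : Fin m → ℤ)
    (k : Fin m) (y : ℤ) : Prop :=
  k ∈ preW (slr y) ∨ (act (rst k).pc = true ∧ M.ridx k ≤ g k)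

def WLoc (slr : ℤ → List (Entry m n)) (M : MVal m) (rst : Fin m → RState m n) (g : Fin m → ℤ)
    (s : WState m n) : Prop :=
  match s.pc with
  | .scanH => hasW (slr s.mc.widx) = false → ∀ k ∈ s.toHelp, Safe slr M rst g k s.mc.widx
  | .post => hasW (slr s.mc.widx) = false → ∀ k ∈ s.toHelp, Safe slr M rst g k s.mc.widx
  | .scanS => hasW (slr s.mc.widx) = false → (∀ k ∈ s.toHelp, Safe slr M rst g k s.mc.widx) ∧
      ∀ hk : s.k < m, Safe slr M rst g ⟨s.k, hk⟩ s.mc.widx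
  | .postR => hasW (slr s.mc.widx) = true
  | .postV => s.win <+: slr s.mc.widx ∧ hasW s.win = true
  | .postM => s.win <+: slr s.mc.widx ∧ hasW s.win = true ∧ s.val = wval (slr (s.mc.widx - 1))
  | _ => True

structure WI (slr : ℤ → List (Entry m n)) (M : MVal m) (rst : Fin m → RState m n) (g : Fin m → ℤ)
    (s : WState m n) : Prop where
  mok : MOK slr M s.mc
  loc : WLoc slr M rst g s

structure AI (slr : ℤ → List (Entry m n)) (M : MVal m) (s : AState m n) : Prop where
  mok : MOK slr M s.mc
  pre : s.pc = .aV ∨ s.pc = .aret → s.win <+: slr s.mc.widx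
  val : s.pc = .aret → s.val = wval (slr (s.mc.widx - 1))

structure Inv (c : Config m n) (g : Fin m → ℤ) : Prop where
  si : SI c.slr c.M
  r : ∀ i, RI c.slr c.M (c.H i) i (c.rst i) (g i)
  w : ∀ j, WI c.slr c.M c.rst g (c.wst j)
  a : ∀ a, AI c.slr c.M (c.ast a)

/-! ### Frame lemmas -/

section frame
variable {slr slr' : ℤ → List (Entry m n)} {M M' : MVal m}

theorem Rec.mono (hpre : ∀ x, slr x <+: slr' x) {i y} (h : Rec slr i y) : Rec slr' i y :=
  readersOf_mono (hpre y) h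

theorem SI.wval_eq (h : SI slr M) (hpre : ∀ x, slr x <+: slr' x) {y : ℤ} (h0 : 0 ≤ y)
    (h1 : y ≤ M.widx) : wval (slr' (y - 1)) = wval (slr (y - 1)) :=
  wval_pre (hpre _) (h.full _ (by omega) (by omega))

theorem MOK.slr_mono (hsi : SI slr M) (hpre : ∀ x, slr x <+: slr' x) {v} (h : MOK slr M v) :
    MOK slr' M v := by
  refine ⟨h.nn, h.le, h.eq, fun k u hku => ?_⟩
  obtain ⟨y, h0, h1, h2, h3⟩ := h.aud k u hku
  have := h.le
  exact ⟨y, h0, h1, h2.mono hpre, by rw [hsi.wval_eq hpre h0 (by omega), h3]⟩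

theorem LV.mono (hsi : SI slr M) (hpre : ∀ x, slr x <+: slr' x) {i s}
    (h : LV slr i s) : LV slr' i s :=
  ⟨h.1.mono hpre, by rw [hsi.wval_eq hpre (hsi.rec_nn h.1) (hsi.rec_le h.1), h.2]⟩

theorem RI.frame {hh i s g} (h : RI slr M hh i s g) (hsi : SI slr M)
    (hpre : ∀ x, slr x <+: slr' x) (hM : M.widx ≤ M'.widx)
    (hmok : ∀ u, MOK slr M u → MOK slr' M' u)
    (hnew : ∀ y, Rec slr' i y → Rec slr i y ∨
      (y = M.widx ∧ act s.pc = true ∧ g < y ∧ ∀ y', Rec slr i y' → y' ≤ g)) :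
    RI slr' M' hh i s g := by
  have hlM := h.lM
  have hg1 := h.g1
  have hgl := h.gl
  refine ⟨hmok _ h.mok, h.g1, h.gl, by omega, h.hl, h.grec.imp id (·.mono hpre), ?_, ?_, ?_⟩
  · intro y hy hgy
    rcases hnew y hy with h1 | h1
    · exact h.low y h1 hgy
    · omega
  · intro y y' hy hy' hgy hgy'
    rcases hnew y hy with h1 | ⟨h1, -, -, h1'⟩ <;> rcases hnew y' hy' with h2 | ⟨h2, -, -, h2'⟩
    · exact h.uniq y y' h1 h2 hgy hgy'
    · have := h2' y h1; omega
    · have := h1' y' h2; omega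
    · omega
  · have hl := h.loc
    have hle : act s.pc = false → (∀ y, Rec slr i y → y ≤ s.lsr) →
        ∀ y, Rec slr' i y → y ≤ s.lsr := by
      intro ha hy y hr
      rcases hnew y hr with h1 | ⟨_, h1, _⟩
      · exact hy y h1
      · simp [ha] at h1
    have hp : ∀ {l}, l <+: slr s.lsr → l <+: slr' s.lsr := fun hl => hl.trans (hpre _)
    have hlv : g < s.lsr → s.lval = wval (slr (s.lsr - 1)) → s.lval = wval (slr' (s.lsr - 1)) := by
      intro h1 h2
      rw [hsi.wval_eq hpre (by omega) hlM, h2]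
    unfold RLoc at hl ⊢
    cases hpc : s.pc <;> simp only [hpc] at hl hle ⊢
    · exact ⟨hl.1.imp id (·.mono hsi hpre), hle rfl hl.2⟩
    · exact ⟨hl.1, hl.2.1.mono hsi hpre, hle rfl hl.2.2⟩
    · exact ⟨hl.1, hl.2.1.mono hsi hpre, hp hl.2.2.1, hl.2.2.2⟩
    · exact ⟨hl.1, hl.2.1.mono hsi hpre, hp hl.2.2.1, hl.2.2.2⟩
    · refine ⟨by omega, fun y hy hgy => ?_⟩
      rcases hnew y hy with h1 | h1
      · exact hl.2 y h1 hgy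
      · omega
    · exact ⟨hl.1.mono hpre, hle rfl hl.2⟩
    · exact hl
    · exact hl
    · exact ⟨hl.1, hl.2.1, (hpre _).subset hl.2.2⟩
    · exact ⟨hl.1, hl.2.1, hp hl.2.2.1, hl.2.2.2⟩
    · exact ⟨hl.1, hl.2.1, hp hl.2.2.1, hl.2.2.2.1, hlv hl.1 hl.2.2.2.2⟩
    · exact ⟨hl.1, hl.2.1, hp hl.2.2.1, hl.2.2.2.1, hlv hl.1 hl.2.2.2.2.1,
        fun h => lt_of_lt_of_le (hl.2.2.2.2.2 h) hM⟩
    · exact ⟨hl.1.imp id (·.mono hsi hpre), hle rfl hl.2⟩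

theorem WI.frame {rst rst' : Fin m → RState m n} {g g' : Fin m → ℤ} {s : WState m n}
    (h : WI slr M rst g s) (hsi : SI slr M)
    (hpre : ∀ x, slr x <+: slr' x)
    (hmok : ∀ u, MOK slr M u → MOK slr' M' u)
    (hsafe : ∀ k, hasW (slr' s.mc.widx) = false → Safe slr M rst g k s.mc.widx →
      Safe slr' M' rst' g' k s.mc.widx) :
    WI slr' M' rst' g' s := by
  refine ⟨hmok _ h.mok, ?_⟩
  have hl := h.loc
  have hle := h.mok.le
  have hnn := h.mok.nn
  have hW : hasW (slr' s.mc.widx) = false → hasW (slr s.mc.widx) = false := by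
    intro h1
    by_contra h2
    have := hasW_pre (hpre _) (by simpa using h2)
    simp [h1] at this
  unfold WLoc at hl ⊢
  cases hpc : s.pc <;> simp only [hpc] at hl ⊢
  · exact fun h1 k hk => hsafe k h1 (hl (hW h1) k hk)
  · exact fun h1 => ⟨fun k hk => hsafe k h1 ((hl (hW h1)).1 k hk),
      fun hk => hsafe _ h1 ((hl (hW h1)).2 hk)⟩
  · exact fun h1 k hk => hsafe k h1 (hl (hW h1) k hk)
  · exact hasW_pre (hpre _) hl
  · exact ⟨hl.1.trans (hpre _), hl.2⟩
  · exact ⟨hl.1.trans (hpre _), hl.2.1, by rw [hsi.wval_eq hpre hnn hle, hl.2.2]⟩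

theorem AI.frame {s : AState m n} (h : AI slr M s) (hsi : SI slr M)
    (hpre : ∀ x, slr x <+: slr' x)
    (hmok : ∀ u, MOK slr M u → MOK slr' M' u) : AI slr' M' s :=
  ⟨hmok _ h.mok, fun hp => (h.pre hp).trans (hpre _),
    fun hp => by rw [hsi.wval_eq hpre h.mok.nn h.mok.le, h.val hp]⟩

end frame

/-! ### Memory changes -/

theorem app_pre (slr : ℤ → List (Entry m n)) (x : ℤ) (e : Entry m n) (y : ℤ) :
    slr y <+: Function.update slr x (slr x ++ [e]) y := by
  by_cases h : y = x
  · subst h; simp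
  · simp [h]

theorem app_rec {slr : ℤ → List (Entry m n)} {x : ℤ} {e : Entry m n} {k : Fin m} {y : ℤ}
    (h : Rec (Function.update slr x (slr x ++ [e])) k y) :
    Rec slr k y ∨ (y = x ∧ hasW (slr x) = false ∧ k ∈ readersOf (slr x ++ [e]) ∧
      k ∉ readersOf (slr x)) := by
  by_cases hy : y = x
  · subst hy
    by_cases hr : Rec slr k y
    · exact Or.inl hr
    · right
      have h' : k ∈ readersOf (slr y ++ [e]) := by simpa [Rec] using h
      refine ⟨rfl, ?_, h', hr⟩
      by_contra hw
      rw [readersOf_append _ (by simpa using hw)] at h'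
      exact hr h'
  · left; simpa [Rec, hy] using h

theorem app_inv {c : Config m n} {g : Fin m → ℤ} (h : Inv c g) (x : ℤ) (e : Entry m n)
    (hx0 : 0 ≤ x) (hx : x ≤ c.M.widx)
    (hnew : ∀ k, hasW (c.slr x) = false → k ∈ readersOf (c.slr x ++ [e]) → k ∉ readersOf (c.slr x) →
      act (c.rst k).pc = true ∧ c.M.ridx k ≤ g k) :
    Inv { c with slr := Function.update c.slr x (c.slr x ++ [e]) } g := by
  have hpre := app_pre c.slr x e
  have hmok : ∀ u, MOK c.slr c.M u → MOK (Function.update c.slr x (c.slr x ++ [e])) c.M u :=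
    fun u hu => hu.slr_mono h.si hpre
  have hxM : hasW (c.slr x) = false → x = c.M.widx := by
    intro h1
    by_contra h2
    have := h.si.full x (by omega) (by omega)
    simp [h1] at this
  refine ⟨?_, ?_, ?_, ?_⟩
  · refine ⟨hmok _ h.si.mok, ?_, ?_, ?_, h.si.rlow, h.si.rhigh, ?_, ?_⟩
    · exact fun y h1 h2 => hasW_pre (hpre y) (h.si.full y h1 h2)
    · intro y hy
      change c.M.widx < y at hy
      have : y ≠ x := by omega
      simpa [this] using h.si.empty y hy
    · intro y hy
      have : y ≠ x := by omega
      simpa [this] using h.si.neg y hy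
    · exact fun k => (h.si.rrec k).imp id (·.mono hpre)
    · intro k y hr hy
      change y < c.M.widx at hy
      rcases app_rec hr with h1 | ⟨rfl, h1, -⟩
      · exact h.si.rmax k y h1 hy
      · have := hxM h1; omega
  · intro i
    refine (h.r i).frame h.si hpre le_rfl hmok fun y hr => ?_
    rcases app_rec hr with h1 | ⟨rfl, h1, h2, h3⟩
    · exact Or.inl h1
    · right
      have hy := hxM h1
      obtain ⟨h4, h5⟩ := hnew i h1 h2 h3
      have hri := h.r i
      have := hri.gl
      have := hri.lM
      refine ⟨hy, h4, ?_, ?_⟩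
      · rcases hri.grec with h6 | h6
        · omega
        · have : g i ≠ y := by rintro h7; rw [h7] at h6; exact h3 h6
          omega
      · intro y' hy'
        have h7 := h.si.rec_le hy'
        have h8 : y' ≠ y := by rintro rfl; exact h3 hy'
        have := h.si.rmax i y' hy' (by omega)
        omega
  · exact fun j => (h.w j).frame h.si hpre hmok fun k _ hs =>
      hs.imp (fun h1 => preW_mono (hpre _) h1) id
  · exact fun a => (h.a a).frame h.si hpre hmok

theorem wmax_inv {c : Config m n} {g : Fin m → ℤ} (h : Inv c g) (mc : MVal m) (x : ℤ)
    (win : List (Entry m n)) (lv : Val) (hmc : MOK c.slr c.M mc) (hmx : mc.widx = x)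
    (hwin : win <+: c.slr x) (hW : hasW win = true) (hlv : lv = wval (c.slr (x - 1))) :
    Inv { c with M := wmax c.M (mArg mc win x lv) } g ∧
      x < (wmax c.M (mArg mc win x lv)).widx := by
  subst hmx
  have hle := hmc.le
  have hnn := hmc.nn
  by_cases hlt : c.M.widx < mc.widx + 1
  swap
  · have : wmax c.M (mArg mc win mc.widx lv) = c.M := by simp [wmax, mArg, hlt]
    rw [this]
    exact ⟨h, by omega⟩
  have heq : mc = c.M := hmc.eq (by omega)
  subst heq
  have hM' : wmax c.M (mArg c.M win c.M.widx lv) = mArg c.M win c.M.widx lv := by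
    simp [wmax, mArg]
  rw [hM']
  have hwx : (mArg c.M win c.M.widx lv).widx = c.M.widx + 1 := rfl
  have hrd : readersOf (c.slr c.M.widx) = readersOf win := readersOf_pre hwin hW
  have hW' := hasW_pre hwin hW
  have hpre : ∀ x, c.slr x <+: c.slr x := fun _ => List.prefix_rfl
  have hmok : ∀ u, MOK c.slr c.M u → MOK c.slr (mArg c.M win c.M.widx lv) u := by
    intro u hu
    have := hu.le
    exact ⟨hu.nn, by omega, fun h => by omega, hu.aud⟩
  refine ⟨⟨?_, ?_, ?_, ?_⟩, by omega⟩
  · change SI c.slr (mArg c.M win c.M.widx lv)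
    refine ⟨⟨by omega, le_rfl, fun _ => rfl, ?_⟩, ?_, ?_, h.si.neg, ?_, ?_, ?_, ?_⟩
    · intro k u hku
      simp only [mArg, Finset.mem_union, Finset.mem_image] at hku
      rcases hku with hku | ⟨k', hk', hkk⟩
      · obtain ⟨y, h1, h2, h3⟩ := hmc.aud k u hku
        exact ⟨y, h1, by omega, h3⟩
      · cases hkk
        exact ⟨c.M.widx, hnn, by omega, by rw [Rec, hrd]; exact hk', hlv⟩
    · intro y h1 h2
      change y < c.M.widx + 1 at h2
      by_cases hy : y = c.M.widx
      · rw [hy]; exact hW'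
      · exact h.si.full y h1 (by omega)
    · intro y hy
      change c.M.widx + 1 < y at hy
      exact h.si.empty y (by omega)
    · intro k
      have := h.si.rlow k
      simp only [mArg]
      split <;> omega
    · intro k
      have := h.si.rhigh k
      simp only [mArg]
      split <;> omega
    · intro k
      simp only [mArg]
      split
      · right; rw [Rec, hrd]; assumption
      · exact h.si.rrec k
    · intro k y hr hy
      change y < c.M.widx + 1 at hy
      simp only [mArg]
      split
      · omega
      · rename_i hk
        have : y ≠ c.M.widx := by rintro rfl; rw [Rec, hrd] at hr; exact hk hr
        exact h.si.rmax k y hr (by omega)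
  · exact fun i => (h.r i).frame h.si hpre (by change _ ≤ c.M.widx + 1; omega) hmok fun y hr => Or.inl hr
  · intro j
    refine (h.w j).frame h.si hpre hmok fun k h1 _ => ?_
    have h2 := (h.w j).mok.le
    have h3 := (h.w j).mok.nn
    exfalso
    by_cases hy : (c.wst j).mc.widx = c.M.widx
    · rw [hy] at h1; simp [hW'] at h1
    · have := h.si.full _ (by omega) (lt_of_le_of_ne h2 hy)
      simp [h1] at this
  · exact fun a => (h.a a).frame h.si hpre hmok

/-! ### Local changes -/

theorem upR_inv {c : Config m n} {g : Fin m → ℤ} (h : Inv c g) (i : Fin m) (s : RState m n)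
    (g' : Fin m → ℤ) (hg : ∀ k, k ≠ i → g' k = g k)
    (hr : RI c.slr c.M (c.H i) i s (g' i))
    (hs : act (c.rst i).pc = true → c.M.ridx i ≤ g i → hasW (c.slr c.M.widx) = false →
      i ∈ preW (c.slr c.M.widx) ∨ (act s.pc = true ∧ g' i = g i)) :
    Inv (upR c i s) g' := by
  refine ⟨h.si, ?_, ?_, h.a⟩
  · intro k
    by_cases hk : k = i
    · subst hk; simpa [upR] using hr
    · simpa [upR, hk, hg k hk] using h.r k
  · intro j
    refine (h.w j).frame h.si (fun _ => List.prefix_rfl) (fun _ h => h) fun k h0 hsf => ?_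
    have h1 : hasW (c.slr (c.wst j).mc.widx) = false := h0
    have h2 := (h.w j).mok.le
    have h3 := (h.w j).mok.nn
    have hy : (c.wst j).mc.widx = c.M.widx := by
      by_contra hy
      have := h.si.full _ (by omega) (lt_of_le_of_ne h2 hy)
      simp [h1] at this
    change Safe c.slr c.M (upR c i s).rst g' k (c.wst j).mc.widx
    change Safe c.slr c.M c.rst g k (c.wst j).mc.widx at hsf
    rw [hy] at h1 hsf ⊢
    by_cases hk : k = i
    · subst hk
      rcases hsf with hsf | ⟨h4, h5⟩
      · exact Or.inl hsf
      · rcases hs h4 h5 h1 with h6 | ⟨h6, h7⟩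
        · exact Or.inl h6
        · right; simp [upR, h6, h7, h5]
    · simpa [Safe, upR, hk, hg k hk] using hsf

theorem upW_inv {c : Config m n} {g : Fin m → ℤ} (h : Inv c g) (j : Fin n) (s : WState m n)
    (hw : WI c.slr c.M c.rst g s) : Inv (upW c j s) g := by
  refine ⟨h.si, h.r, ?_, h.a⟩
  intro k
  by_cases hk : k = j
  · subst hk; simpa [upW] using hw
  · simpa [upW, hk] using h.w k

theorem upA_inv {c : Config m n} {g : Fin m → ℤ} (h : Inv c g) (a : ℕ) (s : AState m n)
    (hw : AI c.slr c.M s) : Inv (upA c a s) g := by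
  refine ⟨h.si, h.r, h.w, ?_⟩
  intro k
  by_cases hk : k = a
  · subst hk; simpa [upA] using hw
  · simpa [upA, hk] using h.a k

/-! ### Ownership of entries: sliding registers never overflow -/

def owner : Entry m n → Fin m ⊕ Fin n
  | .w j _ _ => .inr j
  | .r i => .inl i

def WOwn (M : MVal m) (s : WState m n) (x : ℤ) : Prop :=
  match s.pc with
  | .scanH => x < s.mc.widx
  | .scanS => x < s.mc.widx
  | .post => x < s.mc.widx
  | .postR => x ≤ s.mc.widx
  | .postV => x ≤ s.mc.widx
  | .postM => x ≤ s.mc.widx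
  | _ => x < M.widx

def ROwn (s : RState m n) (x : ℤ) : Prop :=
  x ≤ s.lsr ∧ (s.pc = .annH ∨ s.pc = .wSLR → x < s.lsr)

structure Own (c : Config m n) : Prop where
  nd : ∀ x, 0 ≤ x → ((c.slr x).map owner).Nodup
  r : ∀ i x, 0 ≤ x → Entry.r i ∈ c.slr x → ROwn (c.rst i) x
  w : ∀ j x v h, 0 ≤ x → Entry.w j v h ∈ c.slr x → WOwn c.M (c.wst j) x

theorem slide_eq {l : List (Entry m n)} {e : Entry m n} (h : ((l ++ [e]).map owner).Nodup) :
    slide (m + n) l e = l ++ [e] := by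
  have h1 := h.length_le_card
  simp only [List.length_map, Fintype.card_sum, Fintype.card_fin] at h1
  simp only [slide]
  rw [Nat.sub_eq_zero_of_le h1, List.drop_zero]

theorem upR_own {c : Config m n} (h : Own c) (i : Fin m) (s : RState m n)
    (hr : ∀ x, ROwn (c.rst i) x → ROwn s x) : Own (upR c i s) := by
  refine ⟨h.nd, fun k x h0 hx => ?_, h.w⟩
  by_cases hk : k = i
  · subst hk; simpa [upR] using hr x (h.r k x h0 hx)
  · simpa [upR, hk] using h.r k x h0 hx

theorem upW_own {c : Config m n} (h : Own c) (j : Fin n) (s : WState m n)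
    (hw : ∀ x, WOwn c.M (c.wst j) x → WOwn c.M s x) : Own (upW c j s) := by
  refine ⟨h.nd, h.r, fun k x v hh h0 hx => ?_⟩
  by_cases hk : k = j
  · subst hk; simpa [upW] using hw x (h.w k x v hh h0 hx)
  · simpa [upW, hk] using h.w k x v hh h0 hx

theorem M_own {c : Config m n} (h : Own c) (M : MVal m) (hM : c.M.widx ≤ M.widx) :
    Own { c with M := M } := by
  refine ⟨h.nd, h.r, fun k x v hh h0 hx => ?_⟩
  have := h.w k x v hh h0 hx
  unfold WOwn at this ⊢
  revert this
  dsimp only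
  cases (c.wst k).pc <;> dsimp only <;> omega

theorem wmax_le (M v : MVal m) : M.widx ≤ (wmax M v).widx := by
  unfold wmax; split <;> omega

theorem app_nodup {c : Config m n} (h : Own c) {x : ℤ} (h0 : 0 ≤ x) {e : Entry m n}
    (he : ∀ e' ∈ c.slr x, owner e' ≠ owner e) : ((c.slr x ++ [e]).map owner).Nodup := by
  simp only [List.map_append, List.map_cons, List.map_nil]
  rw [List.nodup_append]
  refine ⟨h.nd x h0, by simp, ?_⟩
  intro a ha b hb
  obtain ⟨e', he', rfl⟩ := List.mem_map.1 ha
  simp only [List.mem_singleton] at hb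
  subst hb
  exact he e' he'

theorem wr_r {c : Config m n} (h : Own c) {i : Fin m} (hpc : (c.rst i).pc = .wSLR)
    (h0 : 0 ≤ (c.rst i).lsr) :
    (((c.slr (c.rst i).lsr) ++ [Entry.r i]).map owner).Nodup := by
  refine app_nodup h h0 fun e' he' heq => ?_
  cases e' with
  | w j v hh => simp [owner] at heq
  | r k =>
    simp only [owner, Sum.inl.injEq] at heq
    subst heq
    have := (h.r k _ h0 he').2 (Or.inr hpc)
    omega

theorem wr_w {c : Config m n} (h : Own c) {j : Fin n} (hpc : (c.wst j).pc = .post)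
    (h0 : 0 ≤ (c.wst j).mc.widx) (v : Val) (hh : Finset (Fin m)) :
    (((c.slr (c.wst j).mc.widx) ++ [Entry.w j v hh]).map owner).Nodup := by
  refine app_nodup h h0 fun e' he' heq => ?_
  cases e' with
  | r k => simp [owner] at heq
  | w k v' hh' =>
    simp only [owner, Sum.inr.injEq] at heq
    subst heq
    have := h.w k _ _ _ h0 he'
    simp [WOwn, hpc] at this

theorem app_own_r {c : Config m n} (h : Own c) (i : Fin m) (hpc : (c.rst i).pc = .wSLR)
    (h0 : 0 ≤ (c.rst i).lsr) :
    Own { upR c i { c.rst i with pc := .rSLR } with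
      slr := Function.update c.slr (c.rst i).lsr (c.slr (c.rst i).lsr ++ [.r i]) } := by
  have hnd := wr_r h hpc h0
  refine ⟨fun x hx => ?_, fun k x hx hk => ?_, fun k x v hh hx hk => ?_⟩
  · by_cases hxe : x = (c.rst i).lsr
    · subst hxe; simpa using hnd
    · simpa [hxe] using h.nd x hx
  · have hold : Entry.r k ∈ c.slr x ∨ (k = i ∧ x = (c.rst i).lsr) := by
      by_cases hxe : x = (c.rst i).lsr
      · subst hxe
        simpa using hk
      · left; simpa [hxe] using hk
    by_cases hki : k = i
    · subst hki
      rcases hold with h1 | h1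
      · have := (h.r k x hx h1).1
        simpa [upR, ROwn] using this
      · simp [upR, ROwn, h1.2]
    · rcases hold with h1 | h1
      · simpa [upR, hki] using h.r k x hx h1
      · exact absurd h1.1 hki
  · have hold : Entry.w k v hh ∈ c.slr x := by
      by_cases hxe : x = (c.rst i).lsr
      · subst hxe
        simpa using hk
      · simpa [hxe] using hk
    exact h.w k x v hh hx hold

theorem app_own_w {c : Config m n} (h : Own c) (j : Fin n) (hpc : (c.wst j).pc = .post)
    (h0 : 0 ≤ (c.wst j).mc.widx) (u : Val) (H : Finset (Fin m)) :
    Own { upW c j { c.wst j with pc := .postR } with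
      slr := Function.update c.slr (c.wst j).mc.widx (c.slr (c.wst j).mc.widx ++ [.w j u H]) } := by
  have hnd := wr_w h hpc h0 u H
  refine ⟨fun x hx => ?_, fun k x hx hk => ?_, fun k x v hh hx hk => ?_⟩
  · by_cases hxe : x = (c.wst j).mc.widx
    · subst hxe; simpa using hnd
    · simpa [hxe] using h.nd x hx
  · have hold : Entry.r k ∈ c.slr x := by
      by_cases hxe : x = (c.wst j).mc.widx
      · subst hxe
        simpa using hk
      · simpa [hxe] using hk
    exact h.r k x hx hold
  · have hold : Entry.w k v hh ∈ c.slr x ∨ (k = j ∧ x = (c.wst j).mc.widx) := by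
      by_cases hxe : x = (c.wst j).mc.widx
      · subst hxe
        simp only [Function.update_self, List.mem_append, List.mem_singleton, Entry.w.injEq] at hk
        exact hk.imp id fun h => ⟨h.1, rfl⟩
      · left; simpa [hxe] using hk
    by_cases hki : k = j
    · subst hki
      rcases hold with h1 | h1
      · have := h.w k x v hh hx h1
        simp only [WOwn, hpc] at this
        simp only [upW, WOwn, Function.update_self]
        omega
      · simp [upW, WOwn, h1.2]
    · rcases hold with h1 | h1
      · simpa [upW, hki] using h.w k x v hh hx h1
      · exact absurd h1.1 hki

/-! ### The invariant is inductive -/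

def gstep (l : Lbl m n) (c : Config m n) (g : Fin m → ℤ) : Fin m → ℤ :=
  match l with
  | .invRead i => Function.update g i (c.rst i).lsr
  | _ => g

theorem RI.upd {slr : ℤ → List (Entry m n)} {M : MVal m} {hh i s g} (h : RI slr M hh i s g)
    (s' : RState m n) (hl : s'.lsr = s.lsr) (hm : s'.mc = s.mc ∨ s'.mc = M) (hsi : SI slr M)
    (hloc : RLoc slr M i s' g) : RI slr M hh i s' g := by
  refine ⟨?_, h.g1, hl ▸ h.gl, hl ▸ h.lM, hl ▸ h.hl, h.grec, hl ▸ h.low, h.uniq, hloc⟩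
  rcases hm with hm | hm <;> rw [hm]
  · exact h.mok
  · exact hsi.mok

theorem step_read {c c' : Config m n} {g : Fin m → ℤ} (h : Inv c g) (ho : Own c) {x win}
    {i : Fin m} (hs : Step c (.slrRead (.rdr i) x win) c') : Inv c' g ∧ Own c' := by
  have hri := h.r i
  have hl := hri.loc
  have hlM := hri.lM
  obtain ⟨rfl, ⟨hpc, rfl, rfl⟩ | ⟨hpc, rfl, rfl⟩ | ⟨hpc, rfl, rfl⟩ | ⟨hpc, rfl, rfl⟩⟩ := hs <;>
    simp only [RLoc, hpc] at hl
  · refine ⟨upR_inv h i _ g (fun _ _ => rfl) (hri.upd _ rfl (Or.inl rfl) h.si ?_) ?_,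
      upR_own ho _ _ ?_⟩
    · cases hw : hasW (c.slr (c.rst i).lsr)
      · exact ⟨Or.inr hl.2.1, hl.2.2⟩
      · exact ⟨hl.1, hl.2.1, List.prefix_rfl, hw⟩
    · simp [hpc, act]
    · intro x hx
      simp only [ROwn, hpc] at hx ⊢
      split <;> simpa using hx
  · refine ⟨upR_inv h i _ g (fun _ _ => rfl) (hri.upd _ rfl (Or.inl rfl) h.si ?_) ?_,
      upR_own ho _ _ ?_⟩
    · exact ⟨Or.inr ⟨hl.1, rfl⟩, hl.2⟩
    · simp [hpc, act]
    · intro x hx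
      simpa [ROwn, hpc] using hx
  · refine ⟨upR_inv h i _ g (fun _ _ => rfl) (hri.upd _ rfl (Or.inl rfl) h.si ?_) ?_,
      upR_own ho _ _ ?_⟩
    · exact ⟨hl.1, hl.2.1, List.prefix_rfl, mem_r hl.2.2⟩
    · simp [act]
    · intro x hx
      simpa [ROwn, hpc] using hx
  · refine ⟨upR_inv h i _ g (fun _ _ => rfl) (hri.upd _ rfl (Or.inl rfl) h.si ?_) ?_,
      upR_own ho _ _ ?_⟩
    · exact ⟨hl.1, hl.2.1, hl.2.2.1, hl.2.2.2, rfl⟩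
    · simp [act]
    · intro x hx
      simpa [ROwn, hpc] using hx

theorem step_readW {c c' : Config m n} {g : Fin m → ℤ} (h : Inv c g) (ho : Own c) {x win}
    {j : Fin n} (hs : Step c (.slrRead (.wtr j) x win) c') : Inv c' g ∧ Own c' := by
  have hri := h.w j
  have hl := hri.loc
  obtain ⟨rfl, ⟨hpc, rfl, hk, rfl⟩ | ⟨hpc, rfl, rfl⟩ | ⟨hpc, rfl, rfl⟩⟩ := hs <;>
    simp only [WLoc, hpc] at hl
  · refine ⟨upW_inv h j _ ⟨hri.mok, ?_⟩, upW_own ho _ _ ?_⟩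
    · intro hw k hkm
      dsimp only at hkm hw
      obtain ⟨h1, h2⟩ := hl hw
      split at hkm
      · exact h1 k hkm
      · rcases Finset.mem_insert.1 hkm with rfl | hkm
        · exact h2 hk
        · exact h1 k hkm
    · intro x hx
      simpa [WOwn, hpc] using hx
  · refine ⟨upW_inv h j _ ⟨hri.mok, ?_⟩, upW_own ho _ _ ?_⟩
    · exact ⟨List.prefix_rfl, hl⟩
    · intro x hx
      simpa [WOwn, hpc] using hx
  · refine ⟨upW_inv h j _ ⟨hri.mok, ?_⟩, upW_own ho _ _ ?_⟩
    · exact ⟨hl.1, hl.2, rfl⟩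
    · intro x hx
      simpa [WOwn, hpc] using hx

theorem upA_own {c : Config m n} (h : Own c) (a : ℕ) (s : AState m n) : Own (upA c a s) :=
  ⟨h.nd, h.r, h.w⟩

theorem step_readA {c c' : Config m n} {g : Fin m → ℤ} (h : Inv c g) (ho : Own c) {x win}
    {a : ℕ} (hs : Step c (.slrRead (.adt a) x win) c') : Inv c' g ∧ Own c' := by
  have hri := h.a a
  obtain ⟨rfl, ⟨hpc, rfl, rfl⟩ | ⟨hpc, rfl, rfl⟩⟩ := hs
  · exact ⟨upA_inv h a _ ⟨hri.mok, fun _ => List.prefix_rfl, fun h => by simp at h⟩, upA_own ho _ _⟩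
  · exact ⟨upA_inv h a _ ⟨hri.mok, fun _ => hri.pre (Or.inl hpc), fun _ => rfl⟩, upA_own ho _ _⟩

/-- Effect of a write to a sliding register on the recorded readers. -/
theorem new_r {c : Config m n} {g : Fin m → ℤ} (h : Inv c g) {i : Fin m}
    (hpc : (c.rst i).pc = .wSLR) (k : Fin m) (hW : hasW (c.slr (c.rst i).lsr) = false)
    (hk : k ∈ readersOf (c.slr (c.rst i).lsr ++ [.r i]))
    (hk' : k ∉ readersOf (c.slr (c.rst i).lsr)) :
    k = i ∧ act (c.rst k).pc = true ∧ c.M.ridx k ≤ g k := by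
  have hki : k = i := by
    have hW2 : hasW (c.slr (c.rst i).lsr ++ [.r i]) = false := by
      simp [hasW_append, hW]; simp [hasW, Entry.isW]
    rw [readersOf_noW hW2, preW_append' _ hW] at hk
    rw [readersOf_noW hW] at hk'
    simpa [hk', preW] using hk
  subst hki
  refine ⟨rfl, by simp [hpc, act], ?_⟩
  have hri := h.r k
  have hl := hri.loc
  simp only [RLoc, hpc] at hl
  have hg1 := hri.g1
  have hlM := hri.lM
  have hx : (c.rst k).lsr = c.M.widx := by
    by_contra hne
    have := h.si.full _ (by omega) (lt_of_le_of_ne hlM hne)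
    simp [hW] at this
  by_contra hgt
  have := h.si.rhigh k
  rcases h.si.rrec k with h1 | h1
  · omega
  · have := hri.low _ h1 (by omega)
    omega

theorem new_w {c : Config m n} {g : Fin m → ℤ} (h : Inv c g) {j : Fin n}
    (hpc : (c.wst j).pc = .post) (u : Val) (k : Fin m)
    (hW : hasW (c.slr (c.wst j).mc.widx) = false)
    (hk : k ∈ readersOf (c.slr (c.wst j).mc.widx ++ [.w j u (c.wst j).toHelp]))
    (hk' : k ∉ readersOf (c.slr (c.wst j).mc.widx)) :
    act (c.rst k).pc = true ∧ c.M.ridx k ≤ g k := by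
  have hl := (h.w j).loc
  simp only [WLoc, hpc] at hl
  rw [readersOf_noW hW] at hk'
  rw [readersOf, preW_append' _ hW, firstW_append' _ hW] at hk
  have hk2 : k ∈ (c.wst j).toHelp := by simpa [hk', preW, firstW] using hk
  exact (hl hW k hk2).resolve_left hk'

theorem step_writeR {c c' : Config m n} {g : Fin m → ℤ} (h : Inv c g) (ho : Own c) {x e}
    {i : Fin m} (hs : Step c (.slrWrite (.rdr i) x e) c') :
    Inv c' g ∧ Own c' ∧ c'.slr = Function.update c.slr x (c.slr x ++ [e]) := by
  have hri := h.r i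
  obtain ⟨hpc, rfl, rfl, rfl⟩ := hs
  have hl := hri.loc
  simp only [RLoc, hpc] at hl
  have h0 : 0 ≤ (c.rst i).lsr := by have := hri.g1; omega
  rw [slide_eq (wr_r ho hpc h0)]
  refine ⟨?_, app_own_r ho i hpc h0, rfl⟩
  have h1 := app_inv h (c.rst i).lsr (.r i) h0 hri.lM
    (fun k hW hk hk' => (new_r h hpc k hW hk hk').2)
  refine upR_inv h1 i _ g (fun _ _ => rfl) ((h1.r i).upd _ rfl (Or.inl rfl) h1.si ?_) ?_
  · exact ⟨hl.1, hl.2, by simp⟩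
  · simp [act]

theorem step_writeW {c c' : Config m n} {g : Fin m → ℤ} (h : Inv c g) (ho : Own c) {x e}
    {j : Fin n} (hs : Step c (.slrWrite (.wtr j) x e) c') :
    Inv c' g ∧ Own c' ∧ c'.slr = Function.update c.slr x (c.slr x ++ [e]) := by
  have hri := h.w j
  obtain ⟨hpc, rfl, rfl, rfl⟩ := hs
  have h0 : 0 ≤ (c.wst j).mc.widx := hri.mok.nn
  rw [slide_eq (wr_w ho hpc h0 _ _)]
  refine ⟨?_, app_own_w ho j hpc h0 _ _, rfl⟩
  have h1 := app_inv h (c.wst j).mc.widx (.w j (c.wst j).v (c.wst j).toHelp) h0 hri.mok.le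
    (fun k hW hk hk' => new_w h hpc _ k hW hk hk')
  refine upW_inv h1 j _ ⟨(h1.w j).mok, ?_⟩
  simp [WLoc, hasW_append]
  simp [hasW, Entry.isW]

theorem step_mReadR {c c' : Config m n} {g : Fin m → ℤ} (h : Inv c g) (ho : Own c) {v}
    {i : Fin m} (hs : Step c (.mRead (.rdr i) v) c') : Inv c' g ∧ Own c' := by
  have hri := h.r i
  have hl := hri.loc
  have hlM := hri.lM
  have hgl := hri.gl
  have hhl := hri.hl
  obtain ⟨rfl, ⟨hpc, rfl⟩ | ⟨hpc, rfl⟩⟩ := hs <;>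
    simp only [RLoc, hpc] at hl
  · refine ⟨upR_inv h i _ g (fun _ _ => rfl) (hri.upd _ rfl (Or.inr rfl) h.si ?_) ?_,
      upR_own ho _ _ ?_⟩
    · by_cases hw : c.M.widx = (c.rst i).lsr
      · simp only [RLoc, hw, if_true]
        exact ⟨hl.1, hl.2.1, hl.2.2.1, hl.2.2.2, trivial⟩
      · simp only [RLoc, hw, if_false]
        exact ⟨by omega, fun y hy hgy => by omega⟩
    · intro _ _ _; right
      refine ⟨?_, rfl⟩
      dsimp only; split <;> rfl
    · intro x hx
      simp only [ROwn, hpc] at hx ⊢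
      split <;> simpa using hx
  · by_cases hlt : (c.rst i).lsr < c.M.ridx i
    · simp only [hlt, if_true]
      have h1 := h.si.rhigh i
      have hg1 := hri.g1
      have hrec : Rec c.slr i (c.M.ridx i) := (h.si.rrec i).resolve_left (by omega)
      have hall : ∀ y, Rec c.slr i y → y ≤ c.M.ridx i := by
        intro y hy
        by_cases hgy : g i < y
        · rw [hri.uniq y _ hy hrec hgy (by omega)]
        · omega
      refine ⟨upR_inv h i _ g (fun _ _ => rfl)
        ⟨h.si.mok, hri.g1, by dsimp only; omega, by dsimp only; omega, by dsimp only; omega,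
          hri.grec, ?_, hri.uniq, ?_⟩ ?_,
        upR_own ho _ _ ?_⟩
      · intro y hy hgy
        exact (hri.uniq y _ hy hrec hgy (by omega)).ge
      · exact ⟨hrec, hall⟩
      · intro _ h2; omega
      · intro x hx
        simp only [ROwn, hpc] at hx ⊢
        simp; omega
    · simp only [hlt, if_false]
      refine ⟨upR_inv h i _ g (fun _ _ => rfl)
        ⟨h.si.mok, hri.g1, by dsimp only; omega, le_rfl, by dsimp only; omega,
          hri.grec, ?_, hri.uniq, ?_⟩ ?_,
        upR_own ho _ _ ?_⟩
      · intro y hy hgy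
        dsimp only
        by_contra hy2
        have := h.si.rmax i y hy (by omega)
        have := hl.2 y hy hgy
        omega
      · exact ⟨by dsimp only; omega, rfl⟩
      · intro _ _ _; right; exact ⟨rfl, rfl⟩
      · intro x hx
        simp only [ROwn, hpc] at hx ⊢
        simp; omega

theorem step_mRead {c c' : Config m n} {g : Fin m → ℤ} (h : Inv c g) (ho : Own c) {p v}
    (hs : Step c (.mRead p v) c') : Inv c' g ∧ Own c' := by
  cases p with
  | rdr i => exact step_mReadR h ho hs
  | wtr j =>
    obtain ⟨rfl, hpc, rfl⟩ := hs
    refine ⟨upW_inv h j _ ⟨h.si.mok, ?_⟩, upW_own ho _ _ ?_⟩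
    · intro _ k hk; simp at hk
    · intro x hx
      simpa [WOwn, hpc] using hx
  | adt a =>
    obtain ⟨rfl, hpc, rfl⟩ := hs
    exact ⟨upA_inv h a _ ⟨h.si.mok, fun h => by simp at h, fun h => by simp at h⟩, upA_own ho _ _⟩

theorem step_mWrite {c c' : Config m n} {g : Fin m → ℤ} (h : Inv c g) (ho : Own c) {p v}
    (hs : Step c (.mWrite p v) c') : Inv c' g ∧ Own c' := by
  cases p with
  | rdr i =>
    have hri := h.r i
    have hl := hri.loc
    obtain ⟨hpc, rfl, rfl⟩ | ⟨hpc, hw, rfl, rfl⟩ := hs <;>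
      simp only [RLoc, hpc] at hl
    · obtain ⟨h1, h2⟩ := wmax_inv h (c.rst i).mc (c.rst i).lsr (c.rst i).win (c.rst i).lval
        hri.mok hl.2.2.2.2 hl.2.2.1 hl.2.2.2.1 hl.2.1.2
      refine ⟨upR_inv h1 i _ g (fun _ _ => rfl) ((h1.r i).upd _ rfl (Or.inl rfl) h1.si ?_) ?_,
        upR_own (M_own ho _ (wmax_le _ _)) i _ ?_⟩
      · exact ⟨h2, fun y hy hgy => by dsimp only; omega⟩
      · intro _ _ _; right; exact ⟨rfl, rfl⟩
      · intro x hx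
        simpa [ROwn, hpc] using hx
    · obtain ⟨h1, h2⟩ := wmax_inv h (c.rst i).mc (c.rst i).lsr (c.rst i).win (c.rst i).lval
        hri.mok hl.2.1 hl.2.2.1 hw hl.2.2.2.2
      refine ⟨upR_inv h1 i _ g (fun _ _ => rfl) ((h1.r i).upd _ rfl (Or.inl rfl) h1.si ?_) ?_,
        upR_own (M_own ho _ (wmax_le _ _)) i _ ?_⟩
      · exact ⟨hl.1, hl.2.1, hl.2.2.1, hl.2.2.2.1, hl.2.2.2.2, fun _ => h2⟩
      · intro _ _ _; right; exact ⟨rfl, rfl⟩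
      · intro x hx
        simpa [ROwn, hpc] using hx
  | wtr j =>
    have hri := h.w j
    have hl := hri.loc
    obtain ⟨hpc, rfl, rfl⟩ := hs
    simp only [WLoc, hpc] at hl
    obtain ⟨h1, h2⟩ := wmax_inv h (c.wst j).mc (c.wst j).mc.widx (c.wst j).win (c.wst j).val
        hri.mok rfl hl.1 hl.2.1 hl.2.2
    refine ⟨upW_inv h1 j _ ⟨(h1.w j).mok, trivial⟩,
        upW_own (M_own ho _ (wmax_le _ _)) j _ ?_⟩
    intro x hx
    simp only [WOwn, hpc] at hx ⊢
    omega
  | adt a => exact hs.elim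

theorem step_hRead {c c' : Config m n} {g : Fin m → ℤ} (h : Inv c g) (ho : Own c) {j k a}
    (hs : Step c (.hRead j k a) c') : Inv c' g ∧ Own c' := by
  obtain ⟨hpc, hk, rfl, rfl⟩ := hs
  have hwi := h.w j
  have hl := hwi.loc
  simp only [WLoc, hpc] at hl
  by_cases hlt : (c.wst j).mc.ridx k < c.H k
  · simp only [hlt, if_true]
    refine ⟨upW_inv h j _ ⟨hwi.mok, ?_⟩, upW_own ho _ _ ?_⟩
    · intro hw
      refine ⟨hl hw, fun hk2 => ?_⟩
      have hkk : (⟨(c.wst j).k, hk2⟩ : Fin m) = k := Fin.ext hk.symm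
      dsimp only at hw ⊢
      rw [hkk]
      have hle := hwi.mok.le
      have hnn := hwi.mok.nn
      have hy : (c.wst j).mc.widx = c.M.widx := by
        by_contra hy
        have := h.si.full _ (by omega) (lt_of_le_of_ne hle hy)
        simp [hw] at this
      rw [hwi.mok.eq hy] at hlt hw ⊢
      have hri := h.r k
      have hhl := hri.hl
      have hlM := hri.lM
      have hr1 := h.si.rlow k
      by_cases hact : act (c.rst k).pc = true
      · right
        refine ⟨hact, ?_⟩
        by_contra hgt
        have hg1 := hri.g1
        rcases h.si.rrec k with h1 | h1
        · omega
        · have := hri.low _ h1 (by omega)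
          omega
      · left
        have hrec : (c.rst k).lsr = -1 ∨ Rec c.slr k (c.rst k).lsr := by
          have hloc := hri.loc
          unfold RLoc at hloc
          cases hpc : (c.rst k).pc <;> simp only [hpc, act, not_true] at hact hloc
          · exact hloc.1.imp id (·.1)
          · exact Or.inr hloc.2.1.1
          · exact Or.inr hloc.1
          · exact hloc.1.imp id (·.1)
        have hrec := hrec.resolve_left (by omega)
        have hlsr : (c.rst k).lsr = c.M.widx := by
          by_contra hne
          have := h.si.rmax k _ hrec (by omega)
          omega
        rw [hlsr, Rec, readersOf_noW hw] at hrec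
        exact hrec
    · intro x hx
      simpa [WOwn, hpc] using hx
  · simp only [hlt, if_false]
    refine ⟨upW_inv h j _ ⟨hwi.mok, ?_⟩, upW_own ho _ _ ?_⟩
    · simpa only [WLoc, hpc] using hl
    · intro x hx
      simpa [WOwn, hpc] using hx

theorem step_hWrite {c c' : Config m n} {g : Fin m → ℤ} (h : Inv c g) (ho : Own c) {i x}
    (hs : Step c (.hWrite i x) c') : Inv c' g ∧ Own c' := by
  obtain ⟨hpc, rfl, rfl⟩ := hs
  have hl := (h.r i).loc
  simp only [RLoc, hpc] at hl
  have h1 : Inv { c with H := Function.update c.H i (c.rst i).lsr } g := by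
    refine ⟨h.si, fun k => ?_, h.w, h.a⟩
    have hk := h.r k
    refine ⟨hk.mok, hk.g1, hk.gl, hk.lM, ?_, hk.grec, hk.low, hk.uniq, hk.loc⟩
    by_cases hki : k = i
    · subst hki; simp
    · simpa [hki] using hk.hl
  refine ⟨upR_inv h1 i _ g (fun _ _ => rfl) ((h1.r i).upd _ rfl (Or.inl rfl) h1.si ?_) ?_,
      upR_own (c := { c with H := Function.update c.H i (c.rst i).lsr }) ⟨ho.nd, ho.r, ho.w⟩ i _ ?_⟩
  · exact hl
  · intro _ _ _; right; exact ⟨rfl, rfl⟩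
  · intro x hx
    simpa [ROwn, hpc] using hx

theorem step_tau {c c' : Config m n} {g : Fin m → ℤ} (h : Inv c g) (ho : Own c) {p}
    (hs : Step c (.tau p) c') : Inv c' g ∧ Own c' := by
  cases p with
  | rdr i =>
    have hri := h.r i
    have hl := hri.loc
    obtain ⟨hpc, hw, rfl⟩ | ⟨hpc, rfl⟩ := hs <;>
      simp only [RLoc, hpc] at hl
    · refine ⟨upR_inv h i _ g (fun _ _ => rfl) (hri.upd _ rfl (Or.inl rfl) h.si ?_) ?_,
        upR_own ho i _ ?_⟩
      · exact ⟨hl.1, hl.2.1, hl.2.2.1, hl.2.2.2.1, hl.2.2.2.2, fun h => by simp [hw] at h⟩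
      · intro _ _ _; right; exact ⟨rfl, rfl⟩
      · intro x hx
        simpa [ROwn, hpc] using hx
    · obtain ⟨hg, hmc, hwin, hww, hlv, hlt⟩ := hl
      have hg1 := hri.g1
      refine ⟨upR_inv h i _ g (fun _ _ => rfl) (hri.upd _ rfl (Or.inl rfl) h.si ?_) ?_,
        upR_own ho i _ ?_⟩
      · by_cases hin : i ∈ readersOf (c.rst i).win
        · simp only [RLoc, hin, if_true]
          have hrec : Rec c.slr i (c.rst i).lsr := readersOf_mono hwin hin
          refine ⟨Or.inr ⟨hrec, hlv⟩, fun y hy => ?_⟩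
          by_cases hgy : g i < y
          · rw [hri.uniq y _ hy hrec hgy hg]
          · omega
        · simp only [RLoc, hin, if_false]
          have hW : hasW (c.rst i).win = true := hww.resolve_right fun h => hin (preW_sub _ h)
          refine ⟨hlt hW, fun y hy hgy => lt_of_le_of_ne (hri.low y hy hgy) ?_⟩
          rintro rfl
          rw [Rec, readersOf_pre hwin hW] at hy
          exact hin hy
      · intro _ hr hw
        by_cases hin : i ∈ readersOf (c.rst i).win
        · left
          have hrec : Rec c.slr i (c.rst i).lsr := readersOf_mono hwin hin
          have hlM := hri.lM
          have hlsr : (c.rst i).lsr = c.M.widx := by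
            by_contra hne
            have := h.si.rmax i _ hrec (by omega)
            omega
          rw [hlsr, Rec, readersOf_noW hw] at hrec
          exact hrec
        · right
          simp [hin, act]
      · intro x hx
        simp only [ROwn, hpc] at hx ⊢
        split <;> simpa using hx
  | wtr j =>
    have hri := h.w j
    have hl := hri.loc
    obtain ⟨hpc, hk, rfl⟩ := hs
    simp only [WLoc, hpc] at hl
    refine ⟨upW_inv h j _ ⟨hri.mok, hl⟩, upW_own ho _ _ ?_⟩
    intro x hx
    simpa [WOwn, hpc] using hx
  | adt a => exact hs.elim

theorem step_inv {c c' : Config m n} {g : Fin m → ℤ} (h : Inv c g) (ho : Own c) {l}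
    (hs : Step c l c') : Inv c' (gstep l c g) ∧ Own c' := by
  cases l with
  | invRead i =>
    obtain ⟨hpc, rfl⟩ := hs
    have hri := h.r i
    have hl := hri.loc
    simp only [RLoc, hpc] at hl
    have hg1 := hri.g1
    have hgl := hri.gl
    have h0 := h.si.mok.nn
    refine ⟨upR_inv h i _ _ (fun k hk => by simp [gstep, hk]) ?_ ?_, upR_own ho i _ ?_⟩
    · simp only [gstep, Function.update_self]
      refine ⟨hri.mok, by omega, le_rfl, hri.lM, hri.hl, hl.1.imp id (·.1),
        fun y hy hgy => le_of_lt hgy, fun y y' hy hy' hgy hgy' => ?_, ?_⟩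
      · have := hl.2 y hy; omega
      · by_cases hls : 0 ≤ (c.rst i).lsr
        · simp only [RLoc, hls, if_true]
          exact ⟨trivial, hl.1.resolve_left (by omega), hl.2⟩
        · simp only [RLoc, hls, if_false]
          exact ⟨by omega, fun y hy hgy => hgy⟩
    · simp [hpc, act]
    · intro x hx
      simp only [ROwn, hpc] at hx ⊢
      split <;> simpa using hx
  | respRead i v =>
    obtain ⟨hpc, rfl, rfl⟩ := hs
    have hri := h.r i
    have hl := hri.loc
    simp only [RLoc, hpc] at hl
    refine ⟨upR_inv h i _ _ (fun k hk => rfl) (hri.upd _ rfl (Or.inl rfl) h.si hl) ?_,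
      upR_own ho i _ ?_⟩
    · simp [hpc, act]
    · intro x hx
      simpa [ROwn, hpc] using hx
  | invWrite j v =>
    obtain ⟨hpc, rfl⟩ := hs
    refine ⟨upW_inv h j _ ⟨(h.w j).mok, trivial⟩, upW_own ho j _ ?_⟩
    intro x hx
    simpa [WOwn, hpc] using hx
  | respWrite j =>
    obtain ⟨hpc, rfl⟩ := hs
    refine ⟨upW_inv h j _ ⟨(h.w j).mok, trivial⟩, upW_own ho j _ ?_⟩
    intro x hx
    simpa [WOwn, hpc] using hx
  | invAudit a =>
    obtain ⟨hpc, rfl⟩ := hs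
    exact ⟨upA_inv h a _ ⟨(h.a a).mok, fun h => by simp at h, fun h => by simp at h⟩,
      upA_own ho _ _⟩
  | respAudit a A =>
    obtain ⟨hpc, rfl, rfl⟩ := hs
    exact ⟨upA_inv h a _ ⟨(h.a a).mok, fun h => by simp at h, fun h => by simp at h⟩,
      upA_own ho _ _⟩
  | slrRead p x win =>
    cases p with
    | rdr i => exact step_read h ho hs
    | wtr j => exact step_readW h ho hs
    | adt a => exact step_readA h ho hs
  | slrWrite p x e =>
    cases p with
    | rdr i => have := step_writeR h ho hs; exact ⟨this.1, this.2.1⟩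
    | wtr j => have := step_writeW h ho hs; exact ⟨this.1, this.2.1⟩
    | adt a => exact hs.elim
  | mRead p v => exact step_mRead h ho hs
  | mWrite p v => exact step_mWrite h ho hs
  | hRead j k a => exact step_hRead h ho hs
  | hWrite i x => exact step_hWrite h ho hs
  | tau p => exact step_tau h ho hs

theorem init_inv (v0 : Val) (j0 : Fin n) : Inv (init m n v0 j0) (fun _ => -1) ∧
    Own (init m n v0 j0) := by
  have hrd : ∀ y, readersOf ((init m n v0 j0).slr y) = ∅ := by
    intro y
    simp only [init]
    split <;> simp [readersOf, preW, firstW]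
  have hrec : ∀ k y, ¬ Rec (init m n v0 j0).slr k y := by
    intro k y; simp [Rec, hrd]
  have hmok : MOK (init m n v0 j0).slr (init m n v0 j0).M (init m n v0 j0).M :=
    ⟨le_rfl, le_rfl, fun _ => rfl, fun k u h => by simp [init] at h⟩
  refine ⟨⟨⟨hmok, ?_, ?_, fun x _ => hrd x, fun _ => le_rfl, ?_, fun _ => Or.inl rfl,
    fun k y h => absurd h (hrec k y)⟩, ?_, ?_, ?_⟩, ?_⟩
  · intro x h1 h2
    have h2 : x < 0 := h2
    have : x = -1 := by omega
    subst this
    simp [init, hasW, Entry.isW]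
  · intro x hx
    have hx : 0 < x := hx
    have : x ≠ -1 := by omega
    simp [init, this]
  · intro k; simp [init]
  · intro i
    exact ⟨hmok, le_rfl, le_rfl, by simp [init], le_rfl, Or.inl rfl,
      fun y h => absurd h (hrec i y), fun y _ h => absurd h (hrec i y),
      ⟨Or.inl rfl, fun y h => absurd h (hrec i y)⟩⟩
  · intro j
    exact ⟨hmok, trivial⟩
  · intro a
    exact ⟨hmok, fun h => by simp [init] at h, fun h => by simp [init] at h⟩
  · have he : ∀ x : ℤ, 0 ≤ x → (init m n v0 j0).slr x = [] := by
      intro x hx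
      have : x ≠ -1 := by omega
      simp [init, this]
    exact ⟨fun x hx => by simp [he x hx], fun i x hx h => by simp [he x hx] at h,
      fun j x v h hx hh => by simp [he x hx] at hh⟩

/-! ### Trace arguments -/

theorem slr_step {c c' : Config m n} {g : Fin m → ℤ} (h : Inv c g) (ho : Own c) {l}
    (hs : Step c l c') :
    c'.slr = c.slr ∨ ∃ p x e, l = .slrWrite p x e ∧
      c'.slr = Function.update c.slr x (c.slr x ++ [e]) := by
  cases l with
  | slrWrite p x e =>
    right
    refine ⟨p, x, e, rfl, ?_⟩
    cases p with
    | rdr i => exact (step_writeR h ho hs).2.2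
    | wtr j => exact (step_writeW h ho hs).2.2
    | adt a => exact hs.elim
  | invRead i => left; obtain ⟨_, rfl⟩ := hs; rfl
  | respRead i v => left; obtain ⟨_, _, rfl⟩ := hs; rfl
  | invWrite j v => left; obtain ⟨_, rfl⟩ := hs; rfl
  | respWrite j => left; obtain ⟨_, rfl⟩ := hs; rfl
  | invAudit a => left; obtain ⟨_, rfl⟩ := hs; rfl
  | respAudit a A => left; obtain ⟨_, _, rfl⟩ := hs; rfl
  | slrRead p x win =>
    left
    cases p with
    | rdr i => obtain ⟨_, ⟨_, _, rfl⟩ | ⟨_, _, rfl⟩ | ⟨_, _, rfl⟩ | ⟨_, _, rfl⟩⟩ := hs <;> rfl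
    | wtr j => obtain ⟨_, ⟨_, _, _, rfl⟩ | ⟨_, _, rfl⟩ | ⟨_, _, rfl⟩⟩ := hs <;> rfl
    | adt a => obtain ⟨_, ⟨_, _, rfl⟩ | ⟨_, _, rfl⟩⟩ := hs <;> rfl
  | mRead p v =>
    left
    cases p with
    | rdr i => obtain ⟨_, ⟨_, rfl⟩ | ⟨_, rfl⟩⟩ := hs <;> rfl
    | wtr j => obtain ⟨_, _, rfl⟩ := hs; rfl
    | adt a => obtain ⟨_, _, rfl⟩ := hs; rfl
  | mWrite p v =>
    left
    cases p with
    | rdr i => obtain ⟨_, _, rfl⟩ | ⟨_, _, _, rfl⟩ := hs <;> rfl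
    | wtr j => obtain ⟨_, _, rfl⟩ := hs; rfl
    | adt a => exact hs.elim
  | hRead j k a => left; obtain ⟨_, _, _, rfl⟩ := hs; rfl
  | hWrite i x => left; obtain ⟨_, _, rfl⟩ := hs; rfl
  | tau p =>
    left
    cases p with
    | rdr i => obtain ⟨_, _, rfl⟩ | ⟨_, rfl⟩ := hs <;> rfl
    | wtr j => obtain ⟨_, _, rfl⟩ := hs; rfl
    | adt a => exact hs.elim

theorem step_pre {c c' : Config m n} {g : Fin m → ℤ} (h : Inv c g) (ho : Own c) {l}
    (hs : Step c l c') (x : ℤ) : c.slr x <+: c'.slr x := by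
  rcases slr_step h ho hs with h1 | ⟨p, y, e, _, h1⟩ <;> rw [h1]
  exact app_pre c.slr y e x

/-- A reader becomes recorded only in its current, active READ. -/
theorem step_new {c c' : Config m n} {g : Fin m → ℤ} (h : Inv c g) (ho : Own c) {l}
    (hs : Step c l c') {i : Fin m} {y : ℤ} (hr' : Rec c'.slr i y) (hr : ¬ Rec c.slr i y) :
    y = c.M.widx ∧ act (c.rst i).pc = true ∧ g i < y ∧ (∀ y', Rec c.slr i y' → y' ≤ g i) ∧
    (∃ p x e, l = .slrWrite p x e) ∧
    (i ∈ preW (c'.slr y) → l = .slrWrite (.rdr i) y (.r i)) := by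
  rcases slr_step h ho hs with h1 | ⟨p, x, e, rfl, h1⟩
  · rw [h1] at hr'; exact absurd hr' hr
  rw [h1] at hr' ⊢
  rcases app_rec hr' with h2 | ⟨rfl, hW, h3, h4⟩
  · exact absurd h2 hr
  have hkey : act (c.rst i).pc = true ∧ c.M.ridx i ≤ g i ∧ 0 ≤ y ∧ y ≤ c.M.widx ∧
      (i ∈ preW (c.slr y ++ [e]) → Lbl.slrWrite p y e = .slrWrite (.rdr i) y (.r i)) := by
    cases p with
    | rdr k =>
      obtain ⟨hpc, rfl, rfl, -⟩ := hs
      obtain ⟨rfl, h5, h6⟩ := new_r h hpc i hW h3 h4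
      have hri := h.r i
      have hl := hri.loc
      simp only [RLoc, hpc] at hl
      have := hri.g1
      exact ⟨h5, h6, by omega, hri.lM, fun _ => rfl⟩
    | wtr j =>
      obtain ⟨hpc, rfl, rfl, -⟩ := hs
      obtain ⟨h5, h6⟩ := new_w h hpc _ i hW h3 h4
      refine ⟨h5, h6, (h.w j).mok.nn, (h.w j).mok.le, fun hp => ?_⟩
      rw [preW_append' _ hW] at hp
      rw [readersOf_noW hW] at h4
      simp [preW, h4] at hp
    | adt a => exact hs.elim
  obtain ⟨h5, h6, h7, h8, h9⟩ := hkey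
  have hy : y = c.M.widx := by
    by_contra h2
    have := h.si.full y (by omega) (by omega)
    simp [hW] at this
  have hri := h.r i
  have := hri.gl
  have := hri.lM
  refine ⟨hy, h5, ?_, ?_, ⟨p, y, e, rfl⟩, ?_⟩
  · rcases hri.grec with h6 | h6
    · omega
    · have : g i ≠ y := by rintro h7; rw [h7] at h6; exact h4 h6
      omega
  · intro y' hy'
    have h7 := h.si.rec_le hy'
    have h8 : y' ≠ y := by rintro rfl; exact h4 hy'
    have := h.si.rmax i y' hy' (by omega)
    omega
  · simpa using h9

theorem upR_idle {c : Config m n} {k i : Fin m} {s : RState m n} (hk : (c.rst k).pc ≠ .idle)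
    (hs : s.pc ≠ .idle) : ((upR c k s).rst i).pc = .idle ↔ (c.rst i).pc = .idle := by
  by_cases h : i = k
  · subst h; simp [upR, hk, hs]
  · simp [upR, h]

theorem step_idle {c c' : Config m n} {l} (hs : Step c l c') (i : Fin m)
    (h1 : l ≠ .invRead i) (h2 : ¬ isRespOf l (.rdr i)) :
    (c'.rst i).pc = .idle ↔ (c.rst i).pc = .idle := by
  cases l with
  | slrWrite p x e =>
    cases p with
    | rdr k =>
      obtain ⟨hpc, rfl, rfl, rfl⟩ := hs
      exact upR_idle (by simp [hpc]) (by simp)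
    | wtr j => obtain ⟨_, _, _, rfl⟩ := hs; rfl
    | adt a => exact hs.elim
  | invRead k =>
    obtain ⟨_, rfl⟩ := hs
    have : i ≠ k := by rintro rfl; exact h1 rfl
    simp [upR, this]
  | respRead k v =>
    obtain ⟨_, _, rfl⟩ := hs
    have : i ≠ k := by rintro rfl; exact h2 (Or.inl ⟨i, v, rfl, rfl⟩)
    simp [upR, this]
  | invWrite j v => obtain ⟨_, rfl⟩ := hs; rfl
  | respWrite j => obtain ⟨_, rfl⟩ := hs; rfl
  | invAudit a => obtain ⟨_, rfl⟩ := hs; rfl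
  | respAudit a A => obtain ⟨_, _, rfl⟩ := hs; rfl
  | slrRead p x win =>
    cases p with
    | rdr k =>
      obtain ⟨_, ⟨hpc, _, rfl⟩ | ⟨hpc, _, rfl⟩ | ⟨hpc, _, rfl⟩ | ⟨hpc, _, rfl⟩⟩ := hs <;>
        refine upR_idle (by simp [hpc]) ?_ <;> dsimp only <;> (try split) <;> simp
    | wtr j => obtain ⟨_, ⟨_, _, _, rfl⟩ | ⟨_, _, rfl⟩ | ⟨_, _, rfl⟩⟩ := hs <;> rfl
    | adt a => obtain ⟨_, ⟨_, _, rfl⟩ | ⟨_, _, rfl⟩⟩ := hs <;> rfl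
  | mRead p v =>
    cases p with
    | rdr k =>
      obtain ⟨_, ⟨hpc, rfl⟩ | ⟨hpc, rfl⟩⟩ := hs <;>
        refine upR_idle (by simp [hpc]) ?_ <;> (try dsimp only) <;> split <;> simp
    | wtr j => obtain ⟨_, _, rfl⟩ := hs; rfl
    | adt a => obtain ⟨_, _, rfl⟩ := hs; rfl
  | mWrite p v =>
    cases p with
    | rdr k =>
      obtain ⟨hpc, _, rfl⟩ | ⟨hpc, _, _, rfl⟩ := hs <;>
        exact upR_idle (by simp [hpc]) (by simp)
    | wtr j => obtain ⟨_, _, rfl⟩ := hs; rfl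
    | adt a => exact hs.elim
  | hRead j k a => obtain ⟨_, _, _, rfl⟩ := hs; rfl
  | hWrite k x =>
    obtain ⟨hpc, _, rfl⟩ := hs
    exact upR_idle (by simp [hpc]) (by simp)
  | tau p =>
    cases p with
    | rdr k =>
      obtain ⟨hpc, _, rfl⟩ | ⟨hpc, rfl⟩ := hs <;>
        refine upR_idle (by simp [hpc]) ?_ <;> dsimp only <;> (try split) <;> simp
    | wtr j => obtain ⟨_, _, rfl⟩ := hs; rfl
    | adt a => exact hs.elim

theorem upA_keep {c : Config m n} {k a : ℕ} {s : AState m n}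
    (h : (c.ast a).pc = .aV ∨ (c.ast a).pc = .aret)
    (hs : k = a → (s.pc = .aV ∨ s.pc = .aret) ∧ s.win = (c.ast a).win ∧ s.mc = (c.ast a).mc) :
    (((upA c k s).ast a).pc = .aV ∨ ((upA c k s).ast a).pc = .aret) ∧
      ((upA c k s).ast a).win = (c.ast a).win ∧ ((upA c k s).ast a).mc = (c.ast a).mc := by
  by_cases hk : k = a
  · have := hs hk
    subst hk; simpa [upA] using this
  · have : a ≠ k := fun h => hk h.symm
    simpa [upA, this] using h

theorem step_aud {c c' : Config m n} {l} (hs : Step c l c') (a : ℕ)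
    (h : (c.ast a).pc = .aV ∨ (c.ast a).pc = .aret) (h2 : ¬ isRespOf l (.adt a)) :
    ((c'.ast a).pc = .aV ∨ (c'.ast a).pc = .aret) ∧
      (c'.ast a).win = (c.ast a).win ∧ (c'.ast a).mc = (c.ast a).mc := by
  cases l with
  | slrWrite p x e =>
    cases p with
    | rdr k => obtain ⟨_, _, _, rfl⟩ := hs; exact ⟨h, rfl, rfl⟩
    | wtr j => obtain ⟨_, _, _, rfl⟩ := hs; exact ⟨h, rfl, rfl⟩
    | adt a => exact hs.elim
  | invRead k => obtain ⟨_, rfl⟩ := hs; exact ⟨h, rfl, rfl⟩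
  | respRead k v => obtain ⟨_, _, rfl⟩ := hs; exact ⟨h, rfl, rfl⟩
  | invWrite j v => obtain ⟨_, rfl⟩ := hs; exact ⟨h, rfl, rfl⟩
  | respWrite j => obtain ⟨_, rfl⟩ := hs; exact ⟨h, rfl, rfl⟩
  | invAudit k =>
    obtain ⟨hpc, rfl⟩ := hs
    exact upA_keep h (by rintro rfl; simp [hpc] at h)
  | respAudit k A =>
    obtain ⟨_, _, rfl⟩ := hs
    refine upA_keep h ?_
    rintro rfl
    exact absurd (Or.inr (Or.inr ⟨k, A, rfl, rfl⟩)) h2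
  | slrRead p x win =>
    cases p with
    | rdr k =>
      obtain ⟨_, ⟨_, _, rfl⟩ | ⟨_, _, rfl⟩ | ⟨_, _, rfl⟩ | ⟨_, _, rfl⟩⟩ := hs <;>
        exact ⟨h, rfl, rfl⟩
    | wtr j =>
      obtain ⟨_, ⟨_, _, _, rfl⟩ | ⟨_, _, rfl⟩ | ⟨_, _, rfl⟩⟩ := hs <;> exact ⟨h, rfl, rfl⟩
    | adt k =>
      obtain ⟨_, ⟨hpc, _, rfl⟩ | ⟨hpc, _, rfl⟩⟩ := hs
      · exact upA_keep h (by rintro rfl; simp [hpc] at h)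
      · exact upA_keep h (by rintro rfl; simp)
  | mRead p v =>
    cases p with
    | rdr k => obtain ⟨_, ⟨_, rfl⟩ | ⟨_, rfl⟩⟩ := hs <;> exact ⟨h, rfl, rfl⟩
    | wtr j => obtain ⟨_, _, rfl⟩ := hs; exact ⟨h, rfl, rfl⟩
    | adt k =>
      obtain ⟨_, hpc, rfl⟩ := hs
      exact upA_keep h (by rintro rfl; simp [hpc] at h)
  | mWrite p v =>
    cases p with
    | rdr k => obtain ⟨_, _, rfl⟩ | ⟨_, _, _, rfl⟩ := hs <;> exact ⟨h, rfl, rfl⟩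
    | wtr j => obtain ⟨_, _, rfl⟩ := hs; exact ⟨h, rfl, rfl⟩
    | adt a => exact hs.elim
  | hRead j k b => obtain ⟨_, _, _, rfl⟩ := hs; exact ⟨h, rfl, rfl⟩
  | hWrite k x => obtain ⟨_, _, rfl⟩ := hs; exact ⟨h, rfl, rfl⟩
  | tau p =>
    cases p with
    | rdr k => obtain ⟨_, _, rfl⟩ | ⟨_, rfl⟩ := hs <;> exact ⟨h, rfl, rfl⟩
    | wtr j => obtain ⟨_, _, rfl⟩ := hs; exact ⟨h, rfl, rfl⟩
    | adt a => exact hs.elim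

/-- Ghost variable: the value of `lsr` at the last invocation of each reader. -/
def gh (E : Exec m n v0 j0) : ℕ → Fin m → ℤ
  | 0 => fun _ => -1
  | t + 1 => gstep (E.lbl t) (E.cfg t) (gh E t)

theorem inv_at (E : Exec m n v0 j0) (t : ℕ) (ht : t ≤ E.len) :
    Inv (E.cfg t) (gh E t) ∧ Own (E.cfg t) := by
  induction t with
  | zero => rw [E.h0]; exact init_inv v0 j0
  | succ t ih =>
    have := ih (by omega)
    exact step_inv this.1 this.2 (E.hstep t (by omega))

theorem pre_at (E : Exec m n v0 j0) {t t' : ℕ} (htt : t ≤ t') (ht : t' ≤ E.len) (x : ℤ) :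
    (E.cfg t).slr x <+: (E.cfg t').slr x := by
  induction t', htt using Nat.le_induction with
  | base => exact List.prefix_rfl
  | succ t' h ih =>
    have := inv_at E t' (by omega)
    exact (ih (by omega)).trans (step_pre this.1 this.2 (E.hstep t' (by omega)) x)

theorem gstep_eq {l : Lbl m n} {c : Config m n} {g : Fin m → ℤ} {i : Fin m}
    (h : l ≠ .invRead i) : gstep l c g i = g i := by
  cases l with
  | invRead k =>
    have : i ≠ k := by rintro rfl; exact h rfl
    simp [gstep, this]
  | _ => rfl

theorem cur_at (E : Exec m n v0 j0) (i : Fin m) (t : ℕ) (ht : t ≤ E.len)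
    (hpc : ((E.cfg t).rst i).pc ≠ .idle) :
    ∃ τ, τ < t ∧ E.lbl τ = .invRead i ∧
      (∀ s, τ < s → s < t → ¬ isRespOf (E.lbl s) (.rdr i)) ∧
      gh E t i = ((E.cfg τ).rst i).lsr := by
  induction t with
  | zero => rw [E.h0] at hpc; exact absurd rfl hpc
  | succ t ih =>
    have hs := E.hstep t (by omega)
    by_cases h1 : E.lbl t = .invRead i
    · exact ⟨t, by omega, h1, fun s _ _ => by omega, by simp [gh, h1, gstep]⟩
    by_cases h2 : isRespOf (E.lbl t) (.rdr i)
    · exfalso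
      rcases h2 with ⟨k, v, hk, hl⟩ | ⟨j, hk, _⟩ | ⟨a, A, hk, _⟩
      · cases hk
        rw [hl] at hs
        obtain ⟨_, _, h3⟩ := hs
        rw [h3] at hpc
        simp [upR] at hpc
      · cases hk
      · cases hk
    · obtain ⟨τ, h3, h4, h5, h6⟩ := ih (by omega) (by rwa [Ne, ← step_idle hs i h1 h2])
      refine ⟨τ, by omega, h4, fun s hs1 hs2 => ?_, by rw [gh, gstep_eq h1, h6]⟩
      by_cases hst : s = t
      · rw [hst]; exact h2
      · exact h5 s hs1 (by omega)

/-- The READ invoked at `τ` is the one recorded for reader `i` at index `y`. -/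
structure EXD (E : Exec m n v0 j0) (t : ℕ) (i : Fin m) (y : ℤ) (τ : ℕ) : Prop where
  lt : τ < t
  lab : E.lbl τ = .invRead i
  x0 : ((E.cfg τ).rst i).lsr < y
  min : ∀ y', ((E.cfg τ).rst i).lsr < y' → Rec (E.cfg t).slr i y' → y ≤ y'
  dir : ∀ t0, t0 ≤ t → i ∈ preW ((E.cfg t0).slr y) → ∃ key, τ < key ∧ key < t0 ∧
    E.lbl key = .slrWrite (.rdr i) y (.r i) ∧
    ∀ s, τ < s → s < key → ¬ isRespOf (E.lbl s) (.rdr i)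
  st : ((∀ s, τ < s → s < t → ¬ isRespOf (E.lbl s) (.rdr i)) ∧
      gh E t i = ((E.cfg τ).rst i).lsr ∧ ((E.cfg t).rst i).pc ≠ .idle) ∨
    ∃ b, τ < b ∧ b < t ∧ E.lbl b = .respRead i (wval ((E.cfg t).slr (y - 1))) ∧
      ∀ s, τ < s → s < b → ¬ isRespOf (E.lbl s) (.rdr i)

theorem exd_at (E : Exec m n v0 j0) (i : Fin m) (y : ℤ) (t : ℕ) (ht : t ≤ E.len)
    (hr : Rec (E.cfg t).slr i y) : ∃ τ, EXD E t i y τ := by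
  induction t with
  | zero =>
    exfalso
    rw [E.h0] at hr
    simp only [Rec, init] at hr
    split at hr <;> simp [readersOf, preW, firstW] at hr
  | succ t ih =>
    have hs := E.hstep t (by omega)
    obtain ⟨hI, hO⟩ := inv_at E t (by omega)
    have hpre := step_pre hI hO hs
    by_cases hrt : Rec (E.cfg t).slr i y
    · obtain ⟨τ, hx⟩ := ih (by omega) hrt
      have hy0 := hI.si.rec_nn hrt
      have hy1 := hI.si.rec_le hrt
      have hwv := hI.si.wval_eq hpre hy0 hy1
      refine ⟨τ, Nat.lt_succ_of_lt hx.lt, hx.lab, hx.x0, ?_, ?_, ?_⟩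
      · intro y' h1 h2
        by_cases h3 : Rec (E.cfg t).slr i y'
        · exact hx.min y' h1 h3
        · have := (step_new hI hO hs h2 h3).1
          omega
      · intro t0 ht0 hp
        by_cases h1 : t0 = t + 1
        · subst h1
          have hp' : i ∈ preW ((E.cfg t).slr y) := by
            cases hW : hasW ((E.cfg t).slr y) with
            | true =>
              obtain ⟨r, hr⟩ := hpre y
              rw [← hr, preW_append _ hW] at hp
              exact hp
            | false => rwa [Rec, readersOf_noW hW] at hrt
          obtain ⟨key, h2, h3, h4⟩ := hx.dir t le_rfl hp'
          exact ⟨key, h2, by omega, h4⟩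
        · exact hx.dir t0 (by omega) hp
      · rcases hx.st with ⟨h1, h2, h3⟩ | ⟨b, h1, h2, h3, h4⟩
        · by_cases h5 : isRespOf (E.lbl t) (.rdr i)
          · right
            refine ⟨t, hx.lt, by omega, ?_, h1⟩
            rcases h5 with ⟨k, v, hk, hl⟩ | ⟨j, hk, _⟩ | ⟨a, A, hk, _⟩
            · cases hk
              rw [hl] at hs
              obtain ⟨hpc, hv, _⟩ := hs
              have hri := hI.r i
              have hloc := hri.loc
              simp only [RLoc, hpc] at hloc
              have hx0 := hx.x0
              have hg1 := hri.g1
              have hle := hloc.2 y hrt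
              have hlv := hloc.1.resolve_left (by omega)
              have hyl := hri.uniq y _ hrt hlv.1 (by omega) (by omega)
              rw [hl, hv, hwv, hlv.2, ← hyl]
            · cases hk
            · cases hk
          · left
            have h6 : E.lbl t ≠ .invRead i := by
              intro h6
              rw [h6] at hs
              exact h3 hs.1
            refine ⟨fun s hs1 hs2 => ?_, by rw [gh, gstep_eq h6, h2],
              by rwa [Ne, step_idle hs i h6 h5]⟩
            by_cases hst : s = t
            · rw [hst]; exact h5
            · exact h1 s hs1 (by omega)
        · right
          exact ⟨b, h1, by omega, by rw [hwv]; exact h3, h4⟩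
    · obtain ⟨h1, h2, h3, h4, ⟨p, x, e, h5⟩, h6⟩ := step_new hI hO hs hr hrt
      have hpc : ((E.cfg t).rst i).pc ≠ .idle := by
        intro h; simp [h, act] at h2
      obtain ⟨τ, h7, h8, h9, h10⟩ := cur_at E i t (by omega) hpc
      have h11 : ¬ isRespOf (E.lbl t) (.rdr i) := by rw [h5]; simp [isRespOf]
      have h12 : E.lbl t ≠ .invRead i := by rw [h5]; simp
      refine ⟨τ, by omega, h8, by omega, ?_, ?_, Or.inl ⟨fun s hs1 hs2 => ?_,
        by rw [gh, gstep_eq h12, h10], by rwa [Ne, step_idle hs i h12 h11]⟩⟩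
      · intro y' hy1 hy2
        by_cases h13 : Rec (E.cfg t).slr i y'
        · have := h4 y' h13; omega
        · have := (step_new hI hO hs hy2 h13).1
          omega
      · intro t0 ht0 hp
        by_cases h13 : t0 = t + 1
        · subst h13
          exact ⟨t, h7, by omega, h6 hp, h9⟩
        · exfalso
          exact hrt (readersOf_mono (pre_at E (by omega : t0 ≤ t) (by omega) y) (preW_sub _ hp))
      · by_cases hst : s = t
        · rw [hst]; exact h11
        · exact h9 s hs1 (by omega)

theorem mk_op (E : Exec m n v0 j0) (i : Fin m) (y : ℤ) (hr : Rec (E.cfg E.len).slr i y)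
    (t0 : ℕ) (ht0 : t0 ≤ E.len) :
    ∃ o : OpData m n, IsOp E o ∧ o.kind.isRead ∧ o.proc = .rdr i ∧
      o.val = wval ((E.cfg E.len).slr (y - 1)) ∧ o.idx = y ∧ rank o.kind ≤ 1 ∧
      (i ∈ preW ((E.cfg t0).slr y) → o.kind = .directR ∧ o.key < t0) := by
  obtain ⟨τ, hx⟩ := exd_at E i y E.len le_rfl hr
  have hmin : minRecIdx E i ((E.cfg τ).rst i).lsr y :=
    ⟨hx.x0, hr, fun y' h1 h2 h3 => by have := hx.min y' h1 h3; omega⟩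
  obtain ⟨rsp, hrsp, hval⟩ : ∃ rsp : Option ℕ, RespMatch E (.rdr i) τ rsp ∧
      (∀ b, rsp = some b → E.lbl b = .respRead i (wval ((E.cfg E.len).slr (y - 1)))) := by
    rcases hx.st with ⟨h1, _⟩ | ⟨b, h1, h2, h3, h4⟩
    · exact ⟨none, h1, fun b hb => by cases hb⟩
    · exact ⟨some b, ⟨h1, h2, Or.inl ⟨i, _, rfl, h3⟩, h4⟩, fun b' hb => by cases hb; exact h3⟩
  have hRV : ∀ kd key, ReadValOK E ⟨.rdr i, τ, rsp, kd, y, key,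
      wval ((E.cfg E.len).slr (y - 1)), ∅⟩ i := by
    intro kd key
    cases rsp with
    | none => rfl
    | some b => exact hval b rfl
  by_cases hp : i ∈ preW ((E.cfg E.len).slr y)
  · obtain ⟨key, h1, h2, h3, h4, h5⟩ : ∃ key, τ < key ∧ key < E.len ∧
        E.lbl key = .slrWrite (.rdr i) y (.r i) ∧
        (∀ s, τ < s → s < key → ¬ isRespOf (E.lbl s) (.rdr i)) ∧
        (i ∈ preW ((E.cfg t0).slr y) → key < t0) := by
      by_cases hp0 : i ∈ preW ((E.cfg t0).slr y)
      · obtain ⟨key, h1, h2, h3, h4⟩ := hx.dir t0 ht0 hp0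
        exact ⟨key, h1, by omega, h3, h4, fun _ => h2⟩
      · obtain ⟨key, h1, h2, h3, h4⟩ := hx.dir E.len le_rfl hp
        exact ⟨key, h1, h2, h3, h4, fun h => absurd h hp0⟩
    refine ⟨⟨.rdr i, τ, rsp, .directR, y, key, wval ((E.cfg E.len).slr (y - 1)), ∅⟩,
      ⟨hx.lt, hrsp, i, rfl, hx.lab, hmin, hp, h1, h2, h3, ?_, hRV _ _, rfl⟩,
      trivial, rfl, rfl, rfl, by simp [rank], fun h => ⟨rfl, h5 h⟩⟩
    intro b hb
    change rsp = some b at hb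
    subst hb
    have hl := hval b rfl
    by_contra hlt
    have hb1 : τ < b := hrsp.1
    have hne : b ≠ key := by
      rintro rfl
      rw [hl] at h3
      cases h3
    exact h4 b hb1 (by dsimp only at hlt; omega) (Or.inl ⟨i, _, rfl, hl⟩)
  · refine ⟨⟨.rdr i, τ, rsp, .helpedR, y, τ, wval ((E.cfg E.len).slr (y - 1)), ∅⟩,
      ⟨hx.lt, hrsp, i, rfl, hx.lab, hmin, hp, rfl, hRV _ _, rfl⟩,
      trivial, rfl, rfl, rfl, by simp [rank], fun h => ?_⟩
    exact absurd (preW_mono (pre_at E ht0 le_rfl y) h) hp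

/-- What an AUDIT returns. -/
theorem audit_ret (E : Exec m n v0 j0) {a inv key b : ℕ} {x : ℤ} {win : List (Entry m n)}
    {A : Finset (Fin m × Val)} (hi : inv < key) (hkb : key < b)
    (hrm : RespMatch E (.adt a) inv (some b))
    (hkey : E.lbl key = .slrRead (.adt a) x win)
    (hpc : ((E.cfg key).ast a).pc = .aR) (hb : E.lbl b = .respAudit a A)
    (j : Fin m) (v : Val) (hin : (j, v) ∈ A) :
    win = (E.cfg key).slr x ∧ ∃ y, Rec (E.cfg E.len).slr j y ∧
      v = wval ((E.cfg E.len).slr (y - 1)) ∧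
      (y < x ∨ (y = x ∧ j ∈ readersOf win)) := by
  obtain ⟨_, hbl, _, hno⟩ := hrm
  have hs := E.hstep key (by omega)
  rw [hkey] at hs
  obtain ⟨hwin, hs⟩ := hs
  refine ⟨hwin, ?_⟩
  have hs : x = ((E.cfg key).ast a).mc.widx ∧
      E.cfg (key + 1) = upA (E.cfg key) a { (E.cfg key).ast a with win := win, pc := .aV } := by
    rcases hs with ⟨_, h1, h2⟩ | ⟨h0, _⟩
    · exact ⟨h1, h2⟩
    · simp [hpc] at h0
  have hst : ∀ t, key + 1 ≤ t → t ≤ b →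
      (((E.cfg t).ast a).pc = .aV ∨ ((E.cfg t).ast a).pc = .aret) ∧
      ((E.cfg t).ast a).win = win ∧ ((E.cfg t).ast a).mc.widx = x := by
    intro t ht
    induction t, ht using Nat.le_induction with
    | base => intro _; rw [hs.2]; simp [upA, hs.1]
    | succ t ht ih =>
      intro htb
      obtain ⟨h1, h2, h3⟩ := ih (by omega)
      obtain ⟨h4, h5, h6⟩ := step_aud (E.hstep t (by omega)) a h1 (hno t (by omega) (by omega))
      exact ⟨h4, by rw [h5, h2], by rw [h6, h3]⟩
  obtain ⟨_, hw, hmc⟩ := hst b (by omega) le_rfl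
  have hsb := E.hstep b hbl
  rw [hb] at hsb
  obtain ⟨hret, hA, _⟩ := hsb
  obtain ⟨hI, -⟩ := inv_at E b (by omega)
  have hai := hI.a a
  have hpre := pre_at E (le_of_lt hbl) le_rfl
  rw [hA] at hin
  rcases Finset.mem_union.1 hin with hin | hin
  · obtain ⟨y, h0, h1, h2, h3⟩ := hai.mok.aud j v hin
    have := hai.mok.le
    exact ⟨y, h2.mono hpre, by rw [hI.si.wval_eq hpre h0 (by omega), h3], Or.inl (by omega)⟩
  · obtain ⟨k, hk, hkv⟩ := Finset.mem_image.1 hin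
    cases hkv
    have hp := hai.pre (Or.inr hret)
    have hv := hai.val hret
    have hnn := hai.mok.nn
    have hle := hai.mok.le
    rw [hmc] at hp hv hnn hle
    refine ⟨x, Rec.mono hpre (readersOf_mono hp hk), by rw [hI.si.wval_eq hpre hnn hle, hv],
      Or.inr ⟨rfl, by rwa [hw] at hk⟩⟩

/-- Lemma `adt_accurate`.  The AUDIT operations are
accurate: if the response of an AUDIT operation `aop` contains the pair
`(j, v)`, then there exists a READ operation by reader `p_j` returning `v`
that precedes `aop` in the linearization `λ` (any order satisfying rules
`R0`–`R4`, formalized by `LinOK`). -/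
theorem audit_accurate (m n : ℕ) (v0 : Val) (j0 : Fin n) (E : Exec m n v0 j0)
    (lt : OpData m n → OpData m n → Prop) (hlin : LinOK E lt)
    (aop : OpData m n) (ha : IsOp E aop) (hak : aop.kind.isAudit)
    (j : Fin m) (v : Val) (hin : (j, v) ∈ aop.aset) :
    ∃ rop : OpData m n, IsOp E rop ∧ rop.kind.isRead ∧
      rop.proc = .rdr j ∧ rop.val = v ∧ lt rop aop := by
  obtain ⟨-, -, -, hR0, hRk, hKey⟩ := hlin
  have ha0 := ha
  obtain ⟨hinv, hrm, hk⟩ := ha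
  cases hkd : aop.kind <;> simp only [hkd, Kind.isAudit] at hak
  · rw [hkd] at hk
    obtain ⟨a, b, tM, mv, win, hp, hresp, -, h1, h2, h3, -, -, -, hkey, hpc, -, hb, -⟩ := hk
    rw [hp, hresp] at hrm
    obtain ⟨-, y, hr, hv, hy⟩ := audit_ret E (by omega) h3 hrm hkey hpc hb j v hin
    obtain ⟨o, ho, ho1, ho2, ho3, ho4, ho5, -⟩ := mk_op E j y hr 0 (by omega)
    refine ⟨o, ho, ho1, ho2, by rw [ho3, hv], ?_⟩
    rcases hy with hy | ⟨hy, -⟩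
    · exact hR0 o aop ho ha0 (by omega)
    · exact hRk o aop ho ha0 (by omega) (by rw [hkd]; exact lt_of_le_of_lt ho5 (by decide))
  · rw [hkd] at hk
    obtain ⟨a, b, tM, mv, win, hp, hresp, -, h1, h2, h3, -, -, -, hkey, hpc, hW, hb, -⟩ := hk
    rw [hp, hresp] at hrm
    obtain ⟨hwin, y, hr, hv, hy⟩ := audit_ret E (by omega) h3 hrm hkey hpc hb j v hin
    have hbl : b < E.len := hrm.2.1
    obtain ⟨o, ho, ho1, ho2, ho3, ho4, ho5, ho6⟩ := mk_op E j y hr aop.key (by omega)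
    refine ⟨o, ho, ho1, ho2, by rw [ho3, hv], ?_⟩
    rcases hy with hy | ⟨hy, hj⟩
    · exact hR0 o aop ho ha0 (by omega)
    · rw [readersOf_noW hW, hwin, ← hy] at hj
      obtain ⟨h6, h7⟩ := ho6 hj
      exact hKey o aop ho ha0 (by omega) (by rw [h6, hkd]; rfl) (by rw [h6]; simp) h7

end Alg1
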